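/- For every c₁ > 0 there exist universal constants c > 0 and C such that the following holds. Let Z ≥ 1, α > 0, D ≥ 1, and δ with Z^{−1/6} ≤ δ ≤ c; set d = δ·Z^{−1/3} and r = D·Z^{−1/3}, and fix admissible cutoffs θ₀, θ₁ (with gradient constant c₁) and a divergence-free A ∈ C_c^∞(ℝ³,ℝ³). Then for every integer N ≥ C·Z one has E⁰_{N,Z}(A) = E⁰_{N−1,Z}(A), where E⁰_{N,Z}(A) is the infimum of 𝓔⁰_N[Ψ,A] over normalized N-electron wave functions Ψ. -/

import Mathlib

open MeasureTheory

noncomputable section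

/-- Euclidean norm on ℝ³ (encoded as `Fin 3 → ℝ`). -/
def enorm3 (x : Fin 3 → ℝ) : ℝ := Real.sqrt (∑ k, x k ^ 2)

/-- The Pauli matrices σ₁, σ₂, σ₃. -/
def pauli : Fin 3 → Matrix (Fin 2) (Fin 2) ℂ :=
  ![!![0, 1; 1, 0], !![0, -Complex.I; Complex.I, 0], !![1, 0; 0, -1]]

/-- The partial derivative ∂ᵢ Aⱼ of a vector field on ℝ³. -/
def pdVec (A : (Fin 3 → ℝ) → Fin 3 → ℝ) (i j : Fin 3) (x : Fin 3 → ℝ) : ℝ :=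
  fderiv ℝ A x (Pi.single i 1) j

/-- The curl ∇×A of a vector field on ℝ³. -/
def curl3 (A : (Fin 3 → ℝ) → Fin 3 → ℝ) (x : Fin 3 → ℝ) : Fin 3 → ℝ :=
  ![pdVec A 1 2 x - pdVec A 2 1 x, pdVec A 2 0 x - pdVec A 0 2 x,
    pdVec A 0 1 x - pdVec A 1 0 x]

/-- |∇×A|²(x). -/
def curlSq (A : (Fin 3 → ℝ) → Fin 3 → ℝ) (x : Fin 3 → ℝ) : ℝ :=
  ∑ k, (curl3 A x k) ^ 2

/-- |∇⊗A|²(x) = Σᵢⱼ |∂ᵢAⱼ|². -/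
def gradSq (A : (Fin 3 → ℝ) → Fin 3 → ℝ) (x : Fin 3 → ℝ) : ℝ :=
  ∑ i, ∑ j, (pdVec A i j x) ^ 2

/-- A divergence-free smooth compactly supported vector potential. -/
def IsVecPot (A : (Fin 3 → ℝ) → Fin 3 → ℝ) : Prop :=
  ContDiff ℝ (⊤ : ℕ∞) A ∧ HasCompactSupport A ∧ ∀ x, ∑ k, pdVec A k k x = 0

/-- The unit basis vector of the configuration space (ℝ³)^N in direction
(particle j, coordinate k). -/
def eVec (N : ℕ) (j : Fin N) (k : Fin 3) : Fin N → Fin 3 → ℝ :=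
  Pi.single j (Pi.single k 1)

/-- A normalized `N`-electron wave function: smooth, compactly supported,
antisymmetric under simultaneous permutation of position-spin pairs, L²-normalized. -/
structure IsWaveFun (N : ℕ) (Ψ : (Fin N → Fin 3 → ℝ) → (Fin N → Fin 2) → ℂ) : Prop where
  smooth : ∀ s, ContDiff ℝ (⊤ : ℕ∞) fun x => Ψ x s
  compactSupport : ∀ s, HasCompactSupport fun x => Ψ x s
  antisymm : ∀ (π : Equiv.Perm (Fin N)) (x : Fin N → Fin 3 → ℝ) (s : Fin N → Fin 2),
    Ψ (fun i => x (π i)) (fun i => s (π i)) = ((Equiv.Perm.sign π : ℤ) : ℂ) * Ψ x s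
  normalized : ∑ s : Fin N → Fin 2, ∫ x : Fin N → Fin 3 → ℝ, ‖Ψ x s‖ ^ 2 = 1

/-- The expectation ∫ W |Ψ|² of a multiplication operator, including spin summation. -/
def potInt (N : ℕ) (W : (Fin N → Fin 3 → ℝ) → ℝ)
    (Ψ : (Fin N → Fin 3 → ℝ) → (Fin N → Fin 2) → ℂ) : ℝ :=
  ∑ s : Fin N → Fin 2, ∫ x : Fin N → Fin 3 → ℝ, W x * ‖Ψ x s‖ ^ 2

/-- The Pauli kinetic form t_A^{(j)}[Ψ] = ‖σ^{(j)}·(−i∇_{x_j} + A(x_j))Ψ‖². -/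
def pauliKin (N : ℕ) (A : (Fin 3 → ℝ) → Fin 3 → ℝ) (j : Fin N)
    (Ψ : (Fin N → Fin 3 → ℝ) → (Fin N → Fin 2) → ℂ) : ℝ :=
  ∑ s : Fin N → Fin 2, ∫ x : Fin N → Fin 3 → ℝ,
    ‖∑ k : Fin 3, ∑ t : Fin 2, pauli k (s j) t *
      (-Complex.I * fderiv ℝ (fun y => Ψ y (Function.update s j t)) x (eVec N j k)
        + (A (x j) k : ℂ) * Ψ x (Function.update s j t))‖ ^ 2

/-- The closed ball B_ρ = {x ∈ ℝ³ : |x| ≤ ρ}. -/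
def ball3 (ρ : ℝ) : Set (Fin 3 → ℝ) := {x | enorm3 x ≤ ρ}

/-- The gradient of a scalar function on ℝ³. -/
def grad3 (f : (Fin 3 → ℝ) → ℝ) (x : Fin 3 → ℝ) : Fin 3 → ℝ :=
  fun k => fderiv ℝ f x (Pi.single k 1)

/-- Admissible cutoff pair (θ₀, θ₁) on scale d with gradient constant c₁:
smooth [0,1]-valued, θ₀² + θ₁² ≡ 1, θ₁ supported in B_{2d} and ≡ 1 on B_d,
with |∇θ₀|, |∇θ₁| ≤ c₁/d. -/
structure AdmissibleCutoffs (d c₁ : ℝ) (θ₀ θ₁ : (Fin 3 → ℝ) → ℝ) : Prop where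
  smooth₀ : ContDiff ℝ (⊤ : ℕ∞) θ₀
  smooth₁ : ContDiff ℝ (⊤ : ℕ∞) θ₁
  mem₀ : ∀ x, θ₀ x ∈ Set.Icc (0 : ℝ) 1
  mem₁ : ∀ x, θ₁ x ∈ Set.Icc (0 : ℝ) 1
  partition : ∀ x, θ₀ x ^ 2 + θ₁ x ^ 2 = 1
  support₁ : ∀ x, 2 * d < enorm3 x → θ₁ x = 0
  one₁ : ∀ x, enorm3 x ≤ d → θ₁ x = 1
  grad₀ : ∀ x, enorm3 (grad3 θ₀ x) ≤ c₁ / d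
  grad₁ : ∀ x, enorm3 (grad3 θ₁ x) ≤ c₁ / d

/-- The localized potential W_loc(x) = Z/|x| + |∇θ₀(x)|² + |∇θ₁(x)|². -/
def Wloc (Z : ℝ) (θ₀ θ₁ : (Fin 3 → ℝ) → ℝ) (x : Fin 3 → ℝ) : ℝ :=
  Z / enorm3 x + (∑ k, grad3 θ₀ x k ^ 2) + (∑ k, grad3 θ₁ x k ^ 2)

/-- The wave function Ψ multiplied by the cutoff θ evaluated at the j-th
position variable. -/
def cutMul (N : ℕ) (θ : (Fin 3 → ℝ) → ℝ) (j : Fin N)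
    (Ψ : (Fin N → Fin 3 → ℝ) → (Fin N → Fin 2) → ℂ) :
    (Fin N → Fin 3 → ℝ) → (Fin N → Fin 2) → ℂ :=
  fun x s => (θ (x j) : ℂ) * Ψ x s

/-- The truncated functional 𝓔⁰_N[Ψ,A]. -/
def truncEnergy (N : ℕ) (Z α r : ℝ) (θ₀ θ₁ : (Fin 3 → ℝ) → ℝ)
    (A : (Fin 3 → ℝ) → Fin 3 → ℝ)
    (Ψ : (Fin N → Fin 3 → ℝ) → (Fin N → Fin 2) → ℂ) : ℝ :=
  (∑ j : Fin N, (pauliKin N A j (cutMul N θ₀ j Ψ)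
      - potInt N (fun x => Wloc Z θ₀ θ₁ (x j) * θ₀ (x j) ^ 2) Ψ))
    + (∑ i : Fin N, ∑ j : Fin N,
        if i < j then potInt N (fun x => (enorm3 (x i - x j))⁻¹) Ψ else 0)
    + (16 * Real.pi * α ^ 2)⁻¹ * ∫ x in ball3 (3 * r), gradSq A x

/-- The ground state energy E⁰_{N,Z}(A) of the truncated Hamiltonian. -/
def truncGS (N : ℕ) (Z α r : ℝ) (θ₀ θ₁ : (Fin 3 → ℝ) → ℝ)
    (A : (Fin 3 → ℝ) → Fin 3 → ℝ) : ℝ :=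
  sInf {E | ∃ Ψ, IsWaveFun N Ψ ∧ E = truncEnergy N Z α r θ₀ θ₁ A Ψ}

/-! ### The Euclidean norm `enorm3` -/

lemma enorm3_eq_norm (x : Fin 3 → ℝ) :
    enorm3 x = ‖(WithLp.toLp 2 x : EuclideanSpace ℝ (Fin 3))‖ := by
  simp [enorm3, EuclideanSpace.norm_eq]

lemma enorm3_nonneg (x : Fin 3 → ℝ) : 0 ≤ enorm3 x := Real.sqrt_nonneg _

lemma enorm3_zero : enorm3 0 = 0 := by simp [enorm3]

lemma enorm3_sq (x : Fin 3 → ℝ) : enorm3 x ^ 2 = ∑ k, x k ^ 2 :=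
  Real.sq_sqrt (Finset.sum_nonneg fun _ _ => sq_nonneg _)

lemma enorm3_sub_comm (x y : Fin 3 → ℝ) : enorm3 (x - y) = enorm3 (y - x) := by
  simp only [enorm3, Pi.sub_apply]
  congr 1
  exact Finset.sum_congr rfl fun k _ => by ring

lemma enorm3_sub_le (x y : Fin 3 → ℝ) : enorm3 (x - y) ≤ enorm3 x + enorm3 y := by
  simp only [enorm3_eq_norm, WithLp.toLp_sub]
  exact norm_sub_le _ _

lemma continuous_enorm3 : Continuous enorm3 := by
  unfold enorm3
  fun_prop

lemma norm_le_enorm3 (x : Fin 3 → ℝ) : ‖x‖ ≤ enorm3 x := by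
  refine (pi_norm_le_iff_of_nonneg (enorm3_nonneg x)).2 fun k => ?_
  rw [Real.norm_eq_abs]
  refine Real.abs_le_sqrt ?_
  exact Finset.single_le_sum (f := fun k => x k ^ 2) (fun _ _ => sq_nonneg _) (Finset.mem_univ k)

lemma enorm3_pos {x : Fin 3 → ℝ} (hx : x ≠ 0) : 0 < enorm3 x :=
  (norm_pos_iff.2 hx).trans_le (norm_le_enorm3 x)

lemma inv_enorm3_le (x : Fin 3 → ℝ) : (enorm3 x)⁻¹ ≤ ‖x‖⁻¹ := by
  rcases eq_or_ne x 0 with rfl | hx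
  · simp [enorm3_zero]
  · exact inv_anti₀ (norm_pos_iff.2 hx) (norm_le_enorm3 x)

lemma measurable_inv_enorm3 : Measurable fun x : Fin 3 → ℝ => (enorm3 x)⁻¹ :=
  continuous_enorm3.measurable.inv

/-! ### Inserting a coordinate -/

/-- `Fin.insertNth` for constant families. -/
def ins {α : Type*} {n : ℕ} (j : Fin (n + 1)) (a : α) (v : Fin n → α) : Fin (n + 1) → α :=
  Fin.insertNth (α := fun _ => α) j a v

@[simp] lemma ins_self {α : Type*} {n : ℕ} (j : Fin (n + 1)) (a : α) (v : Fin n → α) :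
    ins j a v j = a := by simp [ins]

@[simp] lemma ins_succAbove {α : Type*} {n : ℕ} (j : Fin (n + 1)) (a : α) (v : Fin n → α)
    (i : Fin n) : ins j a v (j.succAbove i) = v i := by simp [ins]

lemma ins_update {α : Type*} {n : ℕ} (j : Fin (n + 1)) (a : α) (v : Fin n → α)
    (i : Fin n) (b : α) :
    Function.update (ins j a v) (j.succAbove i) b = ins j a (Function.update v i b) := by
  ext l
  rcases Fin.eq_self_or_eq_succAbove j l with rfl | ⟨l, rfl⟩
  · simp
  · rcases eq_or_ne l i with rfl | h
    · simp
    · simp [Function.update_of_ne h, Function.update_of_ne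
        (fun h' => h (Fin.succAbove_right_injective h'))]

lemma ins_add_smul {n : ℕ} (j : Fin (n + 1)) (y : Fin 3 → ℝ) (x : Fin n → Fin 3 → ℝ)
    (i : Fin n) (k : Fin 3) (t : ℝ) :
    ins j y (x + t • eVec n i k) = ins j y x + t • eVec (n + 1) (j.succAbove i) k := by
  ext l : 1
  rcases Fin.eq_self_or_eq_succAbove j l with rfl | ⟨l, rfl⟩
  · simp [eVec]
  · rcases eq_or_ne l i with rfl | h
    · simp [eVec]
    · simp [eVec, Pi.single_eq_of_ne h, Pi.single_eq_of_ne
        (fun h' => h (Fin.succAbove_right_injective h'))]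

lemma contDiff_ins {n : ℕ} (j : Fin (n + 1)) (y : Fin 3 → ℝ) :
    ContDiff ℝ (⊤ : ℕ∞) (fun x : Fin n → Fin 3 → ℝ => ins j y x) := by
  refine contDiff_pi.2 fun l => ?_
  rcases Fin.eq_self_or_eq_succAbove j l with rfl | ⟨l, rfl⟩
  · simpa using contDiff_const
  · simpa using contDiff_apply ℝ (Fin 3 → ℝ) l

lemma continuous_ins {n : ℕ} (j : Fin (n + 1)) :
    Continuous (fun p : (Fin 3 → ℝ) × (Fin n → Fin 3 → ℝ) => ins j p.1 p.2) := by
  refine continuous_pi fun l => ?_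
  rcases Fin.eq_self_or_eq_succAbove j l with rfl | ⟨l, rfl⟩
  · simpa using continuous_fst
  · simp only [ins_succAbove]
    fun_prop

lemma norm_le_norm_ins {n : ℕ} (j : Fin (n + 1)) (y : Fin 3 → ℝ) (x : Fin n → Fin 3 → ℝ) :
    ‖x‖ ≤ ‖ins j y x‖ :=
  (pi_norm_le_iff_of_nonneg (norm_nonneg _)).2 fun i => by
    simpa using norm_le_pi_norm (ins j y x) (j.succAbove i)

lemma norm_le_norm_ins' {n : ℕ} (j : Fin (n + 1)) (y : Fin 3 → ℝ) (x : Fin n → Fin 3 → ℝ) :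
    ‖y‖ ≤ ‖ins j y x‖ := by
  simpa using norm_le_pi_norm (ins j y x) j

lemma measurePreserving_ins {n : ℕ} (j : Fin (n + 1)) :
    MeasurePreserving (fun p : (Fin 3 → ℝ) × (Fin n → Fin 3 → ℝ) => ins j p.1 p.2)
      (volume.prod volume) volume :=
  (volume_preserving_piFinSuccAbove (fun _ : Fin (n + 1) => Fin 3 → ℝ) j).symm _

lemma measurableEmbedding_ins {n : ℕ} (j : Fin (n + 1)) :
    MeasurableEmbedding (fun p : (Fin 3 → ℝ) × (Fin n → Fin 3 → ℝ) => ins j p.1 p.2) :=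
  (MeasurableEquiv.piFinSuccAbove (fun _ : Fin (n + 1) => Fin 3 → ℝ) j).symm.measurableEmbedding

/-! ### Integration over position-spin configurations -/

/-- Sum over spins of the integrals over positions. -/
def spinInt {N : ℕ} (f : (Fin N → Fin 3 → ℝ) → (Fin N → Fin 2) → ℝ) : ℝ :=
  ∑ s, ∫ x, f x s

/-- Integrability in the positions, for all spins. -/
def SpinIntegrable {N : ℕ} (f : (Fin N → Fin 3 → ℝ) → (Fin N → Fin 2) → ℝ) : Prop :=
  ∀ s, Integrable fun x => f x s

section SpinInt

variable {N : ℕ} {f g : (Fin N → Fin 3 → ℝ) → (Fin N → Fin 2) → ℝ}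

lemma SpinIntegrable.add (hf : SpinIntegrable f) (hg : SpinIntegrable g) :
    SpinIntegrable fun x s => f x s + g x s := fun s => (hf s).add (hg s)

lemma SpinIntegrable.sub (hf : SpinIntegrable f) (hg : SpinIntegrable g) :
    SpinIntegrable fun x s => f x s - g x s := fun s => (hf s).sub (hg s)

lemma SpinIntegrable.const_mul (c : ℝ) (hf : SpinIntegrable f) :
    SpinIntegrable fun x s => c * f x s := fun s => (hf s).const_mul c

lemma SpinIntegrable.sum {ι : Type*} {F : ι → (Fin N → Fin 3 → ℝ) → (Fin N → Fin 2) → ℝ}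
    (t : Finset ι) (hF : ∀ i, SpinIntegrable (F i)) : SpinIntegrable fun x s => ∑ i ∈ t, F i x s :=
  fun s => integrable_finsetSum t fun i _ => hF i s

lemma spinInt_add (hf : SpinIntegrable f) (hg : SpinIntegrable g) :
    spinInt (fun x s => f x s + g x s) = spinInt f + spinInt g := by
  simp only [spinInt, ← Finset.sum_add_distrib]
  exact Finset.sum_congr rfl fun s _ => integral_add (hf s) (hg s)

lemma spinInt_sub (hf : SpinIntegrable f) (hg : SpinIntegrable g) :
    spinInt (fun x s => f x s - g x s) = spinInt f - spinInt g := by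
  simp only [spinInt, ← Finset.sum_sub_distrib]
  exact Finset.sum_congr rfl fun s _ => integral_sub (hf s) (hg s)

lemma spinInt_const_mul (c : ℝ) : spinInt (fun x s => c * f x s) = c * spinInt f := by
  simp only [spinInt, Finset.mul_sum, integral_const_mul]

lemma spinInt_sum {ι : Type*} {F : ι → (Fin N → Fin 3 → ℝ) → (Fin N → Fin 2) → ℝ}
    (t : Finset ι) (hF : ∀ i, SpinIntegrable (F i)) :
    spinInt (fun x s => ∑ i ∈ t, F i x s) = ∑ i ∈ t, spinInt (F i) := by
  simp only [spinInt]
  rw [Finset.sum_comm]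
  exact Finset.sum_congr rfl fun s _ => integral_finsetSum t fun i _ => hF i s

lemma spinInt_sum_spin_mono (hf : SpinIntegrable f) (hg : SpinIntegrable g)
    (h : ∀ᵐ x, ∑ s, f x s ≤ ∑ s, g x s) : spinInt f ≤ spinInt g := by
  simp only [spinInt]
  rw [← integral_finsetSum _ fun s _ => hf s, ← integral_finsetSum _ fun s _ => hg s]
  exact integral_mono_ae (integrable_finsetSum _ fun s _ => hf s)
    (integrable_finsetSum _ fun s _ => hg s) h

lemma spinInt_mono (hf : SpinIntegrable f) (hg : SpinIntegrable g)
    (h : ∀ᵐ x, ∀ s, f x s ≤ g x s) : spinInt f ≤ spinInt g :=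
  spinInt_sum_spin_mono hf hg <| h.mono fun _ hx => Finset.sum_le_sum fun s _ => hx s

lemma spinInt_nonneg (h : ∀ x s, 0 ≤ f x s) : 0 ≤ spinInt f :=
  Finset.sum_nonneg fun s _ => integral_nonneg fun x => h x s

end SpinInt

lemma sum_ins {n : ℕ} (j : Fin (n + 1)) (F : (Fin (n + 1) → Fin 2) → ℝ) :
    ∑ s, F s = ∑ τ, ∑ s, F (ins j τ s) := by
  rw [← Fintype.sum_prod_type' (f := fun τ s => F (ins j τ s))]
  exact (Fintype.sum_equiv (Fin.insertNthEquiv (fun _ => Fin 2) j) _ _ fun _ => rfl).symm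

section Slicing

variable {n : ℕ} {f g : (Fin (n + 1) → Fin 3 → ℝ) → (Fin (n + 1) → Fin 2) → ℝ}

lemma SpinIntegrable.comp_ins (hf : SpinIntegrable f) (j : Fin (n + 1)) (τ : Fin 2)
    (s : Fin n → Fin 2) :
    Integrable (fun p : (Fin 3 → ℝ) × (Fin n → Fin 3 → ℝ) => f (ins j p.1 p.2) (ins j τ s))
      (volume.prod volume) :=
  ((measurePreserving_ins j).integrable_comp_emb (measurableEmbedding_ins j)).2 (hf (ins j τ s))

lemma SpinIntegrable.integrable_spinInt_ins (hf : SpinIntegrable f) (j : Fin (n + 1))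
    (τ : Fin 2) : Integrable fun y => spinInt fun x s => f (ins j y x) (ins j τ s) :=
  integrable_finsetSum _ fun s _ => (hf.comp_ins j τ s).integral_prod_left

lemma spinInt_ins (hf : SpinIntegrable f) (j : Fin (n + 1)) :
    spinInt f = ∑ τ, ∫ y, spinInt fun x s => f (ins j y x) (ins j τ s) := by
  simp only [spinInt]
  rw [sum_ins j]
  refine Finset.sum_congr rfl fun τ _ => ?_
  rw [integral_finsetSum _ fun s _ => (hf.comp_ins j τ s).integral_prod_left]
  refine Finset.sum_congr rfl fun s _ => ?_
  rw [← (measurePreserving_ins j).integral_comp (measurableEmbedding_ins j)]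
  exact integral_prod _ (hf.comp_ins j τ s)

lemma spinInt_mono_ins (hf : SpinIntegrable f) (hg : SpinIntegrable g) (j : Fin (n + 1))
    (h : ∀ y τ, spinInt (fun x s => f (ins j y x) (ins j τ s)) ≤
      spinInt fun x s => g (ins j y x) (ins j τ s)) : spinInt f ≤ spinInt g := by
  rw [spinInt_ins hf j, spinInt_ins hg j]
  exact Finset.sum_le_sum fun τ _ => integral_mono (hf.integrable_spinInt_ins j τ)
    (hg.integrable_spinInt_ins j τ) fun y => h y τ

end Slicing

/-! ### Integrability of the Coulomb singularity -/

lemma integrable_truncated_inv_norm (R : ℝ) :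
    Integrable fun z : Fin 3 → ℝ => (Set.Iic R).indicator (fun t : ℝ => t⁻¹) ‖z‖ := by
  refine (integrable_fun_norm_addHaar volume (f := (Set.Iic R).indicator fun t : ℝ => t⁻¹)).2 ?_
  have h : IntegrableOn (fun y : ℝ => y) (Set.Ioc 0 R) :=
    (continuous_id.integrableOn_Icc (a := 0) (b := R)).mono_set Set.Ioc_subset_Icc_self
  have h2 : IntegrableOn ((Set.Iic R).indicator fun y : ℝ => y) (Set.Ioi 0) := by
    rw [IntegrableOn, integrable_indicator_iff measurableSet_Iic, IntegrableOn,
      Measure.restrict_restrict measurableSet_Iic]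
    rwa [show Set.Iic R ∩ Set.Ioi 0 = Set.Ioc 0 R by ext y; simp [and_comm]]
  refine h2.congr_fun (fun y hy => ?_) measurableSet_Ioi
  have hy : y ≠ 0 := ne_of_gt hy
  by_cases hR : y ≤ R
  · simp only [Set.indicator, Set.mem_Iic, hR, if_true, Module.finrank_fin_fun, smul_eq_mul]
    field_simp
  · simp [Set.indicator, hR]

lemma integrable_inv_enorm3_mul {N : ℕ} (i j : Fin N) {f : (Fin N → Fin 3 → ℝ) → ℝ}
    (hf : Continuous f) (hc : HasCompactSupport f) :
    Integrable fun x => (enorm3 (x i - x j))⁻¹ * f x := by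
  rcases eq_or_ne j i with rfl | hij
  · simp [enorm3_zero]
  obtain ⟨n, rfl⟩ : ∃ n, N = n + 1 := ⟨N - 1, by have := i.pos; omega⟩
  obtain ⟨j, rfl⟩ := Fin.exists_succAbove_eq hij
  rw [← (measurePreserving_ins i).integrable_comp_emb (measurableEmbedding_ins i)]
  obtain ⟨M, hM⟩ := hc.exists_bound_of_continuous hf
  obtain ⟨R, hR⟩ := hc.isBounded.exists_norm_le
  set h : (Fin 3 → ℝ) → ℝ := fun z => (Set.Iic (2 * R)).indicator (fun t : ℝ => t⁻¹) ‖z‖ with hh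
  have h_int : Integrable h := integrable_truncated_inv_norm (2 * R)
  have h_meas : Measurable h :=
    (measurable_inv.indicator measurableSet_Iic).comp measurable_norm
  set b : (Fin n → Fin 3 → ℝ) → ℝ := (Metric.closedBall 0 R).indicator fun _ => M with hb
  have b_int : Integrable b :=
    (integrable_indicator_iff Metric.isClosed_closedBall.measurableSet).2
      (integrableOn_const (by simp [(isCompact_closedBall (0 : Fin n → Fin 3 → ℝ) R).measure_lt_top.ne]))
  have b_meas : Measurable b :=
    measurable_const.indicator Metric.isClosed_closedBall.measurableSet
  have h_dom : Integrable (fun p : (Fin 3 → ℝ) × (Fin n → Fin 3 → ℝ) => b p.2 * h (p.1 - p.2 j))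
      (volume.prod volume) := by
    refine (integrable_prod_iff' (Measurable.aestronglyMeasurable (by fun_prop))).2
      ⟨Filter.Eventually.of_forall fun x => (h_int.comp_sub_right (x j)).const_mul (b x), ?_⟩
    simp only [norm_mul, integral_const_mul]
    simp_rw [fun x : Fin n → Fin 3 → ℝ => integral_sub_right_eq_self (μ := (volume : Measure (Fin 3 → ℝ)))
      (fun y => ‖h y‖) (x j)]
    exact b_int.norm.mul_const _
  refine h_dom.mono' ?_ (Filter.Eventually.of_forall fun p => ?_)
  · refine Measurable.aestronglyMeasurable ?_
    have h1 : Measurable fun p : (Fin 3 → ℝ) × (Fin n → Fin 3 → ℝ) =>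
        (enorm3 (p.1 - p.2 j))⁻¹ := measurable_inv_enorm3.comp (by fun_prop)
    have h2 : Measurable fun p : (Fin 3 → ℝ) × (Fin n → Fin 3 → ℝ) => f (ins i p.1 p.2) :=
      (hf.comp (continuous_ins i)).measurable
    simp only [Function.comp_def, ins_self, ins_succAbove]
    exact h1.mul h2
  · obtain ⟨y, x⟩ := p
    simp only [Function.comp_apply, ins_self, ins_succAbove]
    have hM0 : 0 ≤ M := (norm_nonneg _).trans (hM 0)
    have hnn : ∀ z, 0 ≤ h z := fun z => by
      simp only [hh, Set.indicator]
      split_ifs <;> positivity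
    by_cases hmem : ins i y x ∈ tsupport f
    · have hle := hR _ hmem
      have hx : ‖x‖ ≤ R := (norm_le_norm_ins i y x).trans hle
      have hy : ‖y‖ ≤ R := (norm_le_norm_ins' i y x).trans hle
      have hyx : ‖y - x j‖ ≤ 2 * R :=
        (norm_sub_le _ _).trans (by linarith [(norm_le_pi_norm x j).trans hx])
      have hbx : b x = M := by simp [hb, hx]
      have hhx : h (y - x j) = ‖y - x j‖⁻¹ := by simp [hh, Set.indicator, hyx]
      rw [hbx, hhx, norm_mul, mul_comm, Real.norm_of_nonneg (inv_nonneg.2 (enorm3_nonneg _))]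
      exact mul_le_mul (hM _) (inv_enorm3_le _) (inv_nonneg.2 (enorm3_nonneg _)) hM0
    · rw [image_eq_zero_of_notMem_tsupport hmem, mul_zero, norm_zero]
      exact mul_nonneg (Set.indicator_nonneg (fun _ _ => hM0) _) (hnn _)

/-! ### Smooth compactly supported functions and the energy density -/

/-- Smoothness and compact support in the positions, for all spins. -/
structure SmoothCompact {N : ℕ} (Ψ : (Fin N → Fin 3 → ℝ) → (Fin N → Fin 2) → ℂ) : Prop where
  smooth : ∀ s, ContDiff ℝ (⊤ : ℕ∞) fun x => Ψ x s
  compactSupport : ∀ s, HasCompactSupport fun x => Ψ x s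

/-- The function `σ⁽ʲ⁾·(−i∇_{x_j} + A(x_j))Ψ`. -/
def pauliDiff (N : ℕ) (A : (Fin 3 → ℝ) → Fin 3 → ℝ) (j : Fin N)
    (Ψ : (Fin N → Fin 3 → ℝ) → (Fin N → Fin 2) → ℂ) (x : Fin N → Fin 3 → ℝ)
    (s : Fin N → Fin 2) : ℂ :=
  ∑ k : Fin 3, ∑ t : Fin 2, pauli k (s j) t *
      (-Complex.I * fderiv ℝ (fun y => Ψ y (Function.update s j t)) x (eVec N j k)
        + (A (x j) k : ℂ) * Ψ x (Function.update s j t))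

/-- The function `(σ⁽ʲ⁾·v)Ψ` at a point, for a vector `v`. -/
def pauliVec {N : ℕ} (j : Fin N) (v : Fin 3 → ℝ) (ψ : (Fin N → Fin 2) → ℂ)
    (s : Fin N → Fin 2) : ℂ :=
  ∑ k : Fin 3, ∑ t : Fin 2, pauli k (s j) t * ((v k : ℂ) * ψ (Function.update s j t))

/-- The Coulomb repulsion of a configuration. -/
def coulomb {N : ℕ} (x : Fin N → Fin 3 → ℝ) : ℝ := 1 / 2 * ∑ i, ∑ j, (enorm3 (x i - x j))⁻¹

/-- The energy density of `Ψ` for the one-body potential `-w`, the cutoff `θ` and the vector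
potential `A`. -/
def enDens {N : ℕ} (w θ : (Fin 3 → ℝ) → ℝ) (A : (Fin 3 → ℝ) → Fin 3 → ℝ)
    (Ψ : (Fin N → Fin 3 → ℝ) → (Fin N → Fin 2) → ℂ) (x : Fin N → Fin 3 → ℝ)
    (s : Fin N → Fin 2) : ℝ :=
  ∑ j, (‖pauliDiff N A j (cutMul N θ j Ψ) x s‖ ^ 2 - w (x j) * ‖Ψ x s‖ ^ 2)
    + coulomb x * ‖Ψ x s‖ ^ 2

/-- The energy of `Ψ` without the field energy. -/
def energy {N : ℕ} (w θ : (Fin 3 → ℝ) → ℝ) (A : (Fin 3 → ℝ) → Fin 3 → ℝ)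
    (Ψ : (Fin N → Fin 3 → ℝ) → (Fin N → Fin 2) → ℂ) : ℝ :=
  spinInt (enDens w θ A Ψ)

/-- The squared `L²` norm. -/
def normSq {N : ℕ} (Ψ : (Fin N → Fin 3 → ℝ) → (Fin N → Fin 2) → ℂ) : ℝ :=
  spinInt fun x s => ‖Ψ x s‖ ^ 2

/-- Antisymmetry under simultaneous permutation of positions and spins. -/
def Antisymm {N : ℕ} (Ψ : (Fin N → Fin 3 → ℝ) → (Fin N → Fin 2) → ℂ) : Prop :=
  ∀ (π : Equiv.Perm (Fin N)) (x : Fin N → Fin 3 → ℝ) (s : Fin N → Fin 2),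
    Ψ (fun i => x (π i)) (fun i => s (π i)) = ((Equiv.Perm.sign π : ℤ) : ℂ) * Ψ x s

lemma coulomb_nonneg {N : ℕ} (x : Fin N → Fin 3 → ℝ) : 0 ≤ coulomb x :=
  mul_nonneg (by norm_num) <| Finset.sum_nonneg fun _ _ => Finset.sum_nonneg fun _ _ =>
    inv_nonneg.2 (enorm3_nonneg _)

lemma normSq_nonneg {N : ℕ} (Ψ : (Fin N → Fin 3 → ℝ) → (Fin N → Fin 2) → ℂ) : 0 ≤ normSq Ψ :=
  spinInt_nonneg fun _ _ => sq_nonneg _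

namespace SmoothCompact

variable {N : ℕ} {Ψ Φ : (Fin N → Fin 3 → ℝ) → (Fin N → Fin 2) → ℂ}

lemma continuous (h : SmoothCompact Ψ) (s : Fin N → Fin 2) : Continuous fun x => Ψ x s :=
  (h.smooth s).continuous

lemma differentiableAt (h : SmoothCompact Ψ) (s : Fin N → Fin 2) (x : Fin N → Fin 3 → ℝ) :
    DifferentiableAt ℝ (fun x => Ψ x s) x :=
  ((h.smooth s).differentiable (by simp)) x

lemma real_mul (h : SmoothCompact Ψ) {J : (Fin N → Fin 3 → ℝ) → ℝ}
    (hJ : ContDiff ℝ (⊤ : ℕ∞) J) : SmoothCompact fun x s => (J x : ℂ) * Ψ x s where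
  smooth s := (Complex.ofRealCLM.contDiff.comp hJ).mul (h.smooth s)
  compactSupport s := (h.compactSupport s).mul_left

lemma const_mul (h : SmoothCompact Ψ) (c : ℂ) : SmoothCompact fun x s => c * Ψ x s where
  smooth s := contDiff_const.mul (h.smooth s)
  compactSupport s := (h.compactSupport s).mul_left

lemma sum {ι : Type*} {F : ι → (Fin N → Fin 3 → ℝ) → (Fin N → Fin 2) → ℂ} (t : Finset ι)
    (hF : ∀ i, SmoothCompact (F i)) : SmoothCompact fun x s => ∑ i ∈ t, F i x s where
  smooth s := ContDiff.sum fun i _ => (hF i).smooth s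
  compactSupport s := by
    classical
    induction t using Finset.induction_on with
    | empty =>
      simp only [Finset.sum_empty]
      exact HasCompactSupport.zero
    | insert a t ha ih =>
      simp only [Finset.sum_insert ha]
      exact ((hF a).compactSupport s).add ih

lemma cutMul (h : SmoothCompact Ψ) {θ : (Fin 3 → ℝ) → ℝ} (hθ : ContDiff ℝ (⊤ : ℕ∞) θ)
    (j : Fin N) : SmoothCompact (cutMul N θ j Ψ) :=
  h.real_mul (J := fun x => θ (x j)) (hθ.comp (contDiff_apply ℝ (Fin 3 → ℝ) j))

lemma continuous_normSq (h : SmoothCompact Ψ) (s : Fin N → Fin 2) :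
    Continuous fun x => ‖Ψ x s‖ ^ 2 := (h.continuous s).norm.pow 2

lemma hasCompactSupport_normSq (h : SmoothCompact Ψ) (s : Fin N → Fin 2) :
    HasCompactSupport fun x => ‖Ψ x s‖ ^ 2 :=
  (h.compactSupport s).comp_left (g := fun z : ℂ => ‖z‖ ^ 2) (by simp)

lemma spinIntegrable_normSq (h : SmoothCompact Ψ) : SpinIntegrable fun x s => ‖Ψ x s‖ ^ 2 :=
  fun s => (h.continuous_normSq s).integrable_of_hasCompactSupport (h.hasCompactSupport_normSq s)

lemma spinIntegrable_bdd_mul (h : SmoothCompact Ψ) {W : (Fin N → Fin 3 → ℝ) → ℝ}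
    (hW : Measurable W) {B : ℝ} (hB : ∀ x, |W x| ≤ B) :
    SpinIntegrable fun x s => W x * ‖Ψ x s‖ ^ 2 :=
  fun s => (h.spinIntegrable_normSq s).bdd_mul hW.aestronglyMeasurable
    (Filter.Eventually.of_forall hB)

lemma spinIntegrable_inv_mul (h : SmoothCompact Ψ) {F : (Fin N → Fin 3 → ℝ) → ℝ}
    (hF : Continuous F) (i j : Fin N) :
    SpinIntegrable fun x s => (enorm3 (x i - x j))⁻¹ * (F x * ‖Ψ x s‖ ^ 2) :=
  fun s => integrable_inv_enorm3_mul i j (hF.mul (h.continuous_normSq s))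
    ((h.hasCompactSupport_normSq s).mul_left)

lemma spinIntegrable_coulomb (h : SmoothCompact Ψ) :
    SpinIntegrable fun x s => coulomb x * ‖Ψ x s‖ ^ 2 := by
  have := (SpinIntegrable.sum Finset.univ fun i => SpinIntegrable.sum Finset.univ fun j =>
    h.spinIntegrable_inv_mul continuous_const (F := fun _ => 1) i j).const_mul (1 / 2)
  simpa [coulomb, Finset.sum_mul, Finset.mul_sum, mul_assoc] using this

lemma spinIntegrable_pauliDiff (h : SmoothCompact Ψ) {A : (Fin 3 → ℝ) → Fin 3 → ℝ}
    (hA : Continuous A) (j : Fin N) :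
    SpinIntegrable fun x s => ‖pauliDiff N A j Ψ x s‖ ^ 2 := by
  intro s
  have h1 : ∀ k t, Continuous fun x =>
      fderiv ℝ (fun y => Ψ y (Function.update s j t)) x (eVec N j k) := fun k t =>
    ((h.smooth _).continuous_fderiv (by simp)).clm_apply continuous_const
  have h2 : ∀ k : Fin 3, Continuous fun x : Fin N → Fin 3 → ℝ => A (x j) k := fun k => by fun_prop
  have h3 := h.continuous
  refine Continuous.integrable_of_hasCompactSupport ?_ ?_
  · unfold pauliDiff
    have : ∀ k : Fin 3, Continuous fun x : Fin N → Fin 3 → ℝ => (A (x j) k : ℂ) := fun k =>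
      Complex.continuous_ofReal.comp (h2 k)
    refine (Continuous.norm ?_).pow 2
    refine continuous_finsetSum _ fun k _ => continuous_finsetSum _ fun t _ => ?_
    exact continuous_const.mul ((continuous_const.mul (h1 k t)).add ((this k).mul (h3 _)))
  · refine HasCompactSupport.comp_left (g := fun z : ℂ => ‖z‖ ^ 2)
      (f := fun x => pauliDiff N A j Ψ x s) ?_ (by simp)
    unfold pauliDiff
    have key : ∀ k t, HasCompactSupport fun x => pauli k (s j) t *
      (-Complex.I * fderiv ℝ (fun y => Ψ y (Function.update s j t)) x (eVec N j k)
        + (A (x j) k : ℂ) * Ψ x (Function.update s j t)) := fun k t =>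
      HasCompactSupport.mul_left <| HasCompactSupport.add
        (((h.compactSupport _).fderiv_apply (𝕜 := ℝ) _).mul_left) ((h.compactSupport _).mul_left)
    have sum_cs : ∀ {m : ℕ} {F : Fin m → (Fin N → Fin 3 → ℝ) → ℂ},
        (∀ i, HasCompactSupport (F i)) → HasCompactSupport fun x => ∑ i, F i x := by
      intro m F hF
      induction m with
      | zero =>
        simp only [Finset.univ_eq_empty, Finset.sum_empty]
        exact HasCompactSupport.zero
      | succ m ih =>
        simp only [Fin.sum_univ_succ]
        exact (hF 0).add (ih fun i => hF i.succ)
    exact sum_cs fun k => sum_cs fun t => key k t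

lemma spinIntegrable_onePot (h : SmoothCompact Ψ) {w : (Fin 3 → ℝ) → ℝ} (hw : Measurable w)
    {B : ℝ} (hB : ∀ y, |w y| ≤ B) (j : Fin N) :
    SpinIntegrable fun x s => w (x j) * ‖Ψ x s‖ ^ 2 :=
  h.spinIntegrable_bdd_mul (W := fun x => w (x j)) (hw.comp (measurable_pi_apply j))
    fun x => hB (x j)

lemma spinIntegrable_enDens (h : SmoothCompact Ψ) {w θ : (Fin 3 → ℝ) → ℝ} (hw : Measurable w)
    {B : ℝ} (hB : ∀ y, |w y| ≤ B) (hθ : ContDiff ℝ (⊤ : ℕ∞) θ) {A : (Fin 3 → ℝ) → Fin 3 → ℝ}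
    (hA : Continuous A) : SpinIntegrable (enDens w θ A Ψ) :=
  (SpinIntegrable.sum _ fun j => ((h.cutMul hθ j).spinIntegrable_pauliDiff hA j).sub
    (h.spinIntegrable_onePot hw hB j)).add h.spinIntegrable_coulomb

end SmoothCompact

lemma coulomb_eq_sum_lt {N : ℕ} (x : Fin N → Fin 3 → ℝ) :
    coulomb x = ∑ i, ∑ j, if i < j then (enorm3 (x i - x j))⁻¹ else 0 := by
  have h : ∑ i, ∑ j, (enorm3 (x i - x j))⁻¹ =
      (∑ i, ∑ j, if i < j then (enorm3 (x i - x j))⁻¹ else 0) +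
      ∑ i, ∑ j, if j < i then (enorm3 (x i - x j))⁻¹ else 0 := by
    simp only [← Finset.sum_add_distrib]
    refine Finset.sum_congr rfl fun i _ => Finset.sum_congr rfl fun j _ => ?_
    rcases lt_trichotomy i j with h | rfl | h
    · simp [h, h.not_gt]
    · simp [enorm3_zero]
    · simp [h, h.not_gt]
  have h2 : (∑ i, ∑ j, if j < i then (enorm3 (x i - x j))⁻¹ else 0) =
      ∑ i, ∑ j, if i < j then (enorm3 (x i - x j))⁻¹ else 0 := by
    rw [Finset.sum_comm]
    simp only [fun i j => enorm3_sub_comm (x i) (x j)]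
  rw [coulomb, h, h2]
  ring

lemma truncEnergy_eq {N : ℕ} {Z α r B : ℝ} {θ₀ θ₁ : (Fin 3 → ℝ) → ℝ}
    {A : (Fin 3 → ℝ) → Fin 3 → ℝ} {Ψ : (Fin N → Fin 3 → ℝ) → (Fin N → Fin 2) → ℂ}
    (h : SmoothCompact Ψ) (hw : Measurable fun y => Wloc Z θ₀ θ₁ y * θ₀ y ^ 2)
    (hB : ∀ y, |Wloc Z θ₀ θ₁ y * θ₀ y ^ 2| ≤ B) (hθ : ContDiff ℝ (⊤ : ℕ∞) θ₀)
    (hA : Continuous A) :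
    truncEnergy N Z α r θ₀ θ₁ A Ψ = energy (fun y => Wloc Z θ₀ θ₁ y * θ₀ y ^ 2) θ₀ A Ψ
      + (16 * Real.pi * α ^ 2)⁻¹ * ∫ x in ball3 (3 * r), gradSq A x := by
  unfold truncEnergy energy enDens
  congr 1
  have hk := fun j => (h.cutMul hθ j).spinIntegrable_pauliDiff hA j
  have hp := fun j => h.spinIntegrable_onePot hw hB j
  rw [spinInt_add (SpinIntegrable.sum _ fun j => (hk j).sub (hp j)) h.spinIntegrable_coulomb,
    spinInt_sum _ fun j => (hk j).sub (hp j)]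
  congr 1
  · exact Finset.sum_congr rfl fun j _ => (spinInt_sub (hk j) (hp j)).symm
  · have hc : ∀ i j : Fin N, SpinIntegrable fun x s =>
        (if i < j then (enorm3 (x i - x j))⁻¹ else 0) * ‖Ψ x s‖ ^ 2 := by
      intro i j
      split_ifs with hij
      · simpa using h.spinIntegrable_inv_mul continuous_const (F := fun _ => 1) i j
      · intro s; simp
    simp only [coulomb_eq_sum_lt, Finset.sum_mul]
    rw [spinInt_sum _ fun i => SpinIntegrable.sum _ fun j => hc i j]
    refine Finset.sum_congr rfl fun i _ => ?_
    rw [spinInt_sum _ fun j => hc i j]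
    refine Finset.sum_congr rfl fun j _ => ?_
    split_ifs
    · rfl
    · simp [spinInt]

lemma IsWaveFun.smoothCompact {N : ℕ} {Ψ : (Fin N → Fin 3 → ℝ) → (Fin N → Fin 2) → ℂ}
    (h : IsWaveFun N Ψ) : SmoothCompact Ψ := ⟨h.smooth, h.compactSupport⟩

lemma IsWaveFun.normSq_eq {N : ℕ} {Ψ : (Fin N → Fin 3 → ℝ) → (Fin N → Fin 2) → ℂ}
    (h : IsWaveFun N Ψ) : normSq Ψ = 1 := h.normalized

section Energy

variable {N : ℕ} {w θ : (Fin 3 → ℝ) → ℝ} {A : (Fin 3 → ℝ) → Fin 3 → ℝ}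
  {Ψ Φ : (Fin N → Fin 3 → ℝ) → (Fin N → Fin 2) → ℂ} {B : ℝ}

lemma neg_mul_normSq_le_energy (h : SmoothCompact Ψ) (hw : Measurable w)
    (hB : ∀ y, |w y| ≤ B) (hθ : ContDiff ℝ (⊤ : ℕ∞) θ) (hA : Continuous A) :
    -(N * B) * normSq Ψ ≤ energy w θ A Ψ := by
  rw [normSq, ← spinInt_const_mul]
  refine spinInt_mono (h.spinIntegrable_normSq.const_mul _)
    (h.spinIntegrable_enDens hw hB hθ hA) (Filter.Eventually.of_forall fun x s => ?_)
  have h1 : ∑ _j : Fin N, -B * ‖Ψ x s‖ ^ 2 ≤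
      ∑ j, (‖pauliDiff N A j (cutMul N θ j Ψ) x s‖ ^ 2 - w (x j) * ‖Ψ x s‖ ^ 2) :=
    Finset.sum_le_sum fun j _ => by
      nlinarith [sq_nonneg ‖pauliDiff N A j (cutMul N θ j Ψ) x s‖, sq_nonneg ‖Ψ x s‖,
        mul_le_mul_of_nonneg_right ((le_abs_self _).trans (hB (x j))) (sq_nonneg ‖Ψ x s‖)]
  have h2 := mul_nonneg (coulomb_nonneg x) (sq_nonneg ‖Ψ x s‖)
  simp only [Finset.sum_const, Finset.card_univ, Fintype.card_fin, nsmul_eq_mul] at h1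
  simp only [enDens]
  linarith

lemma pauliDiff_const_mul (c : ℂ) (h : SmoothCompact Ψ) (j : Fin N) (x : Fin N → Fin 3 → ℝ)
    (s : Fin N → Fin 2) :
    pauliDiff N A j (fun x s => c * Ψ x s) x s = c * pauliDiff N A j Ψ x s := by
  simp only [pauliDiff, Finset.mul_sum]
  refine Finset.sum_congr rfl fun k _ => Finset.sum_congr rfl fun t _ => ?_
  rw [fderiv_const_mul (h.differentiableAt _ x)]
  simp only [_root_.smul_apply, smul_eq_mul]
  ring

lemma enDens_const_mul (c : ℂ) (h : SmoothCompact Ψ) (hθ : ContDiff ℝ (⊤ : ℕ∞) θ)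
    (x : Fin N → Fin 3 → ℝ) (s : Fin N → Fin 2) :
    enDens w θ A (fun x s => c * Ψ x s) x s = ‖c‖ ^ 2 * enDens w θ A Ψ x s := by
  have : ∀ j, cutMul N θ j (fun x s => c * Ψ x s) = fun x s => c * cutMul N θ j Ψ x s := by
    intro j; funext x s; simp only [cutMul]; ring
  simp only [enDens, this, pauliDiff_const_mul c (h.cutMul hθ _), norm_mul, mul_pow, mul_add,
    Finset.mul_sum]
  congr 1
  · exact Finset.sum_congr rfl fun j _ => by ring
  · ring

lemma energy_const_mul (c : ℂ) (h : SmoothCompact Ψ) (hθ : ContDiff ℝ (⊤ : ℕ∞) θ) :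
    energy w θ A (fun x s => c * Ψ x s) = ‖c‖ ^ 2 * energy w θ A Ψ := by
  unfold energy
  rw [← spinInt_const_mul]
  congr 1
  funext x s
  exact enDens_const_mul c h hθ x s

lemma normSq_const_mul (c : ℂ) : normSq (fun x s => c * Ψ x s) = ‖c‖ ^ 2 * normSq Ψ := by
  simp only [normSq, norm_mul, mul_pow, spinInt_const_mul]

lemma Antisymm.isWaveFun_const_mul (ha : Antisymm Ψ) (h : SmoothCompact Ψ)
    (hpos : 0 < normSq Ψ) :
    IsWaveFun N fun x s => (((Real.sqrt (normSq Ψ))⁻¹ : ℝ) : ℂ) * Ψ x s where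
  smooth := (h.const_mul _).smooth
  compactSupport := (h.const_mul _).compactSupport
  antisymm π x s := by simp only [ha π x s]; ring
  normalized := by
    refine (normSq_const_mul (Ψ := Ψ) _).trans ?_
    rw [Complex.norm_real, Real.norm_eq_abs, sq_abs, inv_pow, Real.sq_sqrt hpos.le,
      inv_mul_cancel₀ hpos.ne']

lemma mul_normSq_le_energy {e : ℝ} (he : ∀ Ψ, IsWaveFun N Ψ → e ≤ energy w θ A Ψ)
    (h : SmoothCompact Ψ) (ha : Antisymm Ψ) (hw : Measurable w)
    (hB : ∀ y, |w y| ≤ B) (hθ : ContDiff ℝ (⊤ : ℕ∞) θ) (hA : Continuous A) :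
    e * normSq Ψ ≤ energy w θ A Ψ := by
  rcases (normSq_nonneg Ψ).eq_or_lt with h0 | hpos
  · simpa [← h0] using neg_mul_normSq_le_energy h hw hB hθ hA
  · have := he _ (ha.isWaveFun_const_mul h hpos)
    rw [energy_const_mul _ h hθ, Complex.norm_real, Real.norm_eq_abs, sq_abs, inv_pow,
      Real.sq_sqrt hpos.le] at this
    rwa [inv_mul_eq_div, le_div_iff₀ hpos] at this

lemma enDens_congr {x : Fin N → Fin 3 → ℝ}
    (h : ∀ s, (fun y => Ψ y s) =ᶠ[nhds x] fun y => Φ y s) (s : Fin N → Fin 2) :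
    enDens w θ A Ψ x s = enDens w θ A Φ x s := by
  have h1 : ∀ j t, fderiv ℝ (fun y => cutMul N θ j Ψ y t) x =
      fderiv ℝ (fun y => cutMul N θ j Φ y t) x := fun j t =>
    Filter.EventuallyEq.fderiv_eq ((h t).mono fun y hy => by
      simp only [cutMul]; rw [show Ψ y t = Φ y t from hy])
  have h2 : ∀ t, Ψ x t = Φ x t := fun t => (h t).self_of_nhds
  have h3 : ∀ j t, cutMul N θ j Ψ x t = cutMul N θ j Φ x t := fun j t => by
    simp only [cutMul, h2]
  simp only [enDens, pauliDiff, h1, h2, h3]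

end Energy

/-! ### The localization formula -/

lemma norm_pauli_sum_sq_le (a : Fin 2) (v : Fin 3 → ℝ) (ψ : Fin 2 → ℂ) :
    ‖∑ k, ∑ t, pauli k a t * ((v k : ℂ) * ψ t)‖ ^ 2 ≤ (∑ k, v k ^ 2) * ∑ t, ‖ψ t‖ ^ 2 := by
  have h0 : ∀ z : ℂ, ‖z‖ ^ 2 = z.re ^ 2 + z.im ^ 2 := fun z => by
    rw [Complex.sq_norm, Complex.normSq_apply]; ring
  have e0 : ∀ t, ψ t = ⟨(ψ t).re, (ψ t).im⟩ := fun t => rfl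
  generalize hre : (fun t => (ψ t).re) = p at *
  generalize him : (fun t => (ψ t).im) = q at *
  have hp : ∀ t, (ψ t).re = p t := fun t => congrFun hre t
  have hq : ∀ t, (ψ t).im = q t := fun t => congrFun him t
  fin_cases a
  · simp [pauli, Fin.sum_univ_succ, h0, hp, hq]
    nlinarith [sq_nonneg (v 0 * p 0 - v 1 * q 0 - v 2 * p 1),
      sq_nonneg (v 0 * q 0 + v 1 * p 0 - v 2 * q 1)]
  · simp [pauli, Fin.sum_univ_succ, h0, hp, hq]
    nlinarith [sq_nonneg (v 2 * p 0 + v 0 * p 1 + v 1 * q 1),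
      sq_nonneg (v 2 * q 0 + v 0 * q 1 - v 1 * p 1)]

lemma norm_pauliVec_sq_le {N : ℕ} (j : Fin N) (v : Fin 3 → ℝ) (ψ : (Fin N → Fin 2) → ℂ)
    (s : Fin N → Fin 2) :
    ‖pauliVec j v ψ s‖ ^ 2 ≤ (∑ k, v k ^ 2) * ∑ t, ‖ψ (Function.update s j t)‖ ^ 2 :=
  norm_pauli_sum_sq_le (s j) v fun t => ψ (Function.update s j t)

lemma sum_sum_update {N : ℕ} (j : Fin N) (F : (Fin N → Fin 2) → ℝ) :
    ∑ s, ∑ t, F (Function.update s j t) = 2 * ∑ s, F s := by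
  have : ∑ s, ∑ t, F (Function.update s j t) = ∑ s : Fin N → Fin 2, ∑ _t : Fin 2, F s := by
    rw [← Fintype.sum_prod_type' (f := fun s t => F (Function.update s j t)),
      ← Fintype.sum_prod_type' (f := fun s _ => F s)]
    refine Fintype.sum_equiv
      ⟨fun p => (Function.update p.1 j p.2, p.1 j), fun p => (Function.update p.1 j p.2, p.1 j),
        fun p => ?_, fun p => ?_⟩ _ _ fun p => rfl <;> simp
  rw [this, Finset.mul_sum]
  simp

lemma sum_norm_mul_add_sq {ι : Type*} [Fintype ι] (J : ι → ℝ) (a : ℂ) (b : ι → ℂ)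
    (hJ : ∑ i, J i ^ 2 = 1) (hb : ∑ i, (J i : ℂ) * b i = 0) :
    ∑ i, ‖(J i : ℂ) * a + b i‖ ^ 2 = ‖a‖ ^ 2 + ∑ i, ‖b i‖ ^ 2 := by
  have h : ∀ i, ‖(J i : ℂ) * a + b i‖ ^ 2 =
      J i ^ 2 * ‖a‖ ^ 2 + ‖b i‖ ^ 2 + 2 * (((J i : ℂ) * b i) * (starRingEnd ℂ) a).re := by
    intro i
    simp only [Complex.sq_norm, Complex.normSq_apply, Complex.add_re, Complex.add_im,
      Complex.mul_re, Complex.mul_im, Complex.ofReal_re, Complex.ofReal_im, Complex.conj_re,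
      Complex.conj_im]
    ring
  simp only [h, Finset.sum_add_distrib, ← Finset.sum_mul, ← Finset.mul_sum, hJ, ← Complex.re_sum,
    hb]
  simp

section Localization

variable {N : ℕ} {w θ : (Fin 3 → ℝ) → ℝ} {A : (Fin 3 → ℝ) → Fin 3 → ℝ}
  {Ψ Φ : (Fin N → Fin 3 → ℝ) → (Fin N → Fin 2) → ℂ} {B : ℝ}

/-- The gradient in the position of the `j`-th particle. -/
def partGrad (j : Fin N) (J : (Fin N → Fin 3 → ℝ) → ℝ) (x : Fin N → Fin 3 → ℝ) : Fin 3 → ℝ :=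
  fun k => fderiv ℝ J x (eVec N j k)

lemma fderiv_ofReal_mul {E : Type*} [NormedAddCommGroup E] [NormedSpace ℝ E] {J : E → ℝ}
    {F : E → ℂ} {x : E} (hJ : DifferentiableAt ℝ J x) (hF : DifferentiableAt ℝ F x) (v : E) :
    fderiv ℝ (fun y => (J y : ℂ) * F y) x v =
      (J x : ℂ) * fderiv ℝ F x v + (fderiv ℝ J x v : ℂ) * F x := by
  have := (hJ.hasFDerivAt.smul hF.hasFDerivAt).fderiv
  have h2 : (fun y => (J y : ℂ) * F y) = fun y => J y • F y := by
    funext y; simp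
  rw [h2]
  erw [this]
  simp

lemma pauliDiff_real_mul (h : SmoothCompact Ψ) {J : (Fin N → Fin 3 → ℝ) → ℝ}
    {x : Fin N → Fin 3 → ℝ} (hJ : DifferentiableAt ℝ J x) (j : Fin N) (s : Fin N → Fin 2) :
    pauliDiff N A j (fun x s => (J x : ℂ) * Ψ x s) x s =
      (J x : ℂ) * pauliDiff N A j Ψ x s + -Complex.I * pauliVec j (partGrad j J x) (Ψ x) s := by
  simp only [pauliDiff, pauliVec, partGrad, Finset.mul_sum, ← Finset.sum_add_distrib]
  refine Finset.sum_congr rfl fun k _ => Finset.sum_congr rfl fun t _ => ?_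
  rw [fderiv_ofReal_mul hJ (h.differentiableAt _ x)]
  ring

variable {ι : Type*} [Fintype ι] {J : ι → (Fin N → Fin 3 → ℝ) → ℝ}

lemma sum_mul_partGrad_eq_zero (hJ : ∀ i, ContDiff ℝ (⊤ : ℕ∞) (J i))
    (h1 : ∀ x, ∑ i, J i x ^ 2 = 1) (j : Fin N) (x : Fin N → Fin 3 → ℝ) (k : Fin 3) :
    ∑ i, J i x * partGrad j (J i) x k = 0 := by
  have hd : ∀ i, HasFDerivAt (J i) (fderiv ℝ (J i) x) x := fun i =>
    ((hJ i).differentiable (by simp) x).hasFDerivAt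
  have h2 : HasFDerivAt (fun y => ∑ i, J i y ^ 2)
      (∑ i, (2 * J i x ^ (2 - 1)) • fderiv ℝ (J i) x) x := by
    have := HasFDerivAt.fun_sum (u := Finset.univ) fun i _ => (hd i).pow 2
    simpa using this
  have h3 : HasFDerivAt (fun y => ∑ i, J i y ^ 2) (0 : (Fin N → Fin 3 → ℝ) →L[ℝ] ℝ) x := by
    simp only [h1]
    exact hasFDerivAt_const _ _
  have h4 := congrArg (fun L => L (eVec N j k)) (h2.unique h3)
  simp only [_root_.sum_apply, _root_.smul_apply, smul_eq_mul, mul_assoc,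
    ← Finset.mul_sum, _root_.zero_apply] at h4
  simpa [partGrad] using h4

lemma sum_norm_pauliDiff_sq_le (h : SmoothCompact Ψ) (hJ : ∀ i, ContDiff ℝ (⊤ : ℕ∞) (J i))
    (h1 : ∀ x, ∑ i, J i x ^ 2 = 1) {b : ℝ} (hb : ∀ j x, ∑ i, ∑ k, partGrad j (J i) x k ^ 2 ≤ b)
    (j : Fin N) (x : Fin N → Fin 3 → ℝ) (s : Fin N → Fin 2) :
    ∑ i, ‖pauliDiff N A j (fun x s => (J i x : ℂ) * Ψ x s) x s‖ ^ 2 ≤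
      ‖pauliDiff N A j Ψ x s‖ ^ 2 + b * ∑ t, ‖Ψ x (Function.update s j t)‖ ^ 2 := by
  simp only [fun i => pauliDiff_real_mul (A := A) h ((hJ i).differentiable (by simp) x) j s]
  rw [sum_norm_mul_add_sq _ _ _ (h1 x)]
  · gcongr
    calc ∑ i, ‖-Complex.I * pauliVec j (partGrad j (J i) x) (Ψ x) s‖ ^ 2
        ≤ ∑ i, (∑ k, partGrad j (J i) x k ^ 2) * ∑ t, ‖Ψ x (Function.update s j t)‖ ^ 2 := by
          refine Finset.sum_le_sum fun i _ => ?_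
          simpa using norm_pauliVec_sq_le j (partGrad j (J i) x) (Ψ x) s
      _ ≤ _ := by
          rw [← Finset.sum_mul]
          exact mul_le_mul_of_nonneg_right (hb j x) (Finset.sum_nonneg fun _ _ => sq_nonneg _)
  · have : ∀ i, (J i x : ℂ) * (-Complex.I * pauliVec j (partGrad j (J i) x) (Ψ x) s) =
        ∑ k, ∑ t, ((J i x * partGrad j (J i) x k : ℝ) : ℂ) *
          (-Complex.I * pauli k (s j) t * Ψ x (Function.update s j t)) := by
      intro i
      simp only [pauliVec, Finset.mul_sum]
      refine Finset.sum_congr rfl fun k _ => Finset.sum_congr rfl fun t _ => ?_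
      push_cast
      ring
    simp only [this]
    rw [Finset.sum_comm]
    refine Finset.sum_eq_zero fun k _ => ?_
    rw [Finset.sum_comm]
    refine Finset.sum_eq_zero fun t _ => ?_
    rw [← Finset.sum_mul, ← Complex.ofReal_sum, sum_mul_partGrad_eq_zero hJ h1]
    simp

lemma sum_energy_le (h : SmoothCompact Ψ) (hw : Measurable w) (hB : ∀ y, |w y| ≤ B)
    (hθ : ContDiff ℝ (⊤ : ℕ∞) θ) (hθ1 : ∀ y, |θ y| ≤ 1) (hA : Continuous A)
    (hJ : ∀ i, ContDiff ℝ (⊤ : ℕ∞) (J i)) (h1 : ∀ x, ∑ i, J i x ^ 2 = 1) {b : ℝ} (hb0 : 0 ≤ b)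
    (hb : ∀ j x, ∑ i, ∑ k, partGrad j (J i) x k ^ 2 ≤ b) :
    ∑ i, energy w θ A (fun x s => (J i x : ℂ) * Ψ x s) ≤
      energy w θ A Ψ + 2 * N * b * normSq Ψ := by
  have hi := fun i => (h.real_mul (hJ i)).spinIntegrable_enDens hw hB hθ hA
  have hΨ := h.spinIntegrable_enDens hw hB hθ hA
  have hn := h.spinIntegrable_normSq.const_mul (2 * N * b)
  unfold energy normSq
  rw [← spinInt_sum _ hi, ← spinInt_const_mul, ← spinInt_add hΨ hn]
  refine spinInt_sum_spin_mono (SpinIntegrable.sum _ hi) (hΨ.add hn)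
    (Filter.Eventually.of_forall fun x => ?_)
  have key : ∀ s, ∑ i, enDens w θ A (fun x s => (J i x : ℂ) * Ψ x s) x s ≤
      enDens w θ A Ψ x s + ∑ j, b * ∑ t, ‖Ψ x (Function.update s j t)‖ ^ 2 := by
    intro s
    have hsq : ∀ c : ℝ, ∑ i, c * ‖(J i x : ℂ) * Ψ x s‖ ^ 2 = c * ‖Ψ x s‖ ^ 2 := by
      intro c
      simp only [norm_mul, mul_pow, Complex.norm_real, Real.norm_eq_abs, sq_abs]
      rw [← Finset.mul_sum, ← Finset.sum_mul, h1, one_mul]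
    have hcut : ∀ i j, cutMul N θ j (fun x s => (J i x : ℂ) * Ψ x s) =
        fun x s => (J i x : ℂ) * cutMul N θ j Ψ x s := by
      intro i j; funext x s; simp only [cutMul]; ring
    have hkin : ∀ j, ∑ i, ‖pauliDiff N A j (cutMul N θ j fun x s => (J i x : ℂ) * Ψ x s) x s‖ ^ 2
        ≤ ‖pauliDiff N A j (cutMul N θ j Ψ) x s‖ ^ 2 +
          b * ∑ t, ‖Ψ x (Function.update s j t)‖ ^ 2 := by
      intro j
      simp only [hcut]
      refine (sum_norm_pauliDiff_sq_le (h.cutMul hθ j) hJ h1 hb j x s).trans ?_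
      gcongr with t
      simp only [cutMul, norm_mul, Complex.norm_real, Real.norm_eq_abs]
      exact mul_le_of_le_one_left (norm_nonneg _) (hθ1 _)
    simp only [enDens, Finset.sum_add_distrib, hsq]
    rw [Finset.sum_comm]
    simp only [Finset.sum_sub_distrib, hsq]
    have := Finset.sum_le_sum fun j (_ : j ∈ Finset.univ) => hkin j
    rw [Finset.sum_add_distrib] at this
    linarith
  refine (Finset.sum_le_sum fun s _ => key s).trans (le_of_eq ?_)
  rw [Finset.sum_add_distrib, Finset.sum_add_distrib]
  congr 1
  rw [Finset.sum_comm]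
  simp only [← Finset.mul_sum, sum_sum_update _ fun s => ‖Ψ x s‖ ^ 2]
  simp
  ring

end Localization

/-! ### Removing one particle -/

/-- Extension of a permutation by a fixed point `j`. -/
def extendPerm {n : ℕ} (j : Fin (n + 1)) (π : Equiv.Perm (Fin n)) : Equiv.Perm (Fin (n + 1)) :=
  ((finSuccEquiv' j).symm.symm.trans (Equiv.optionCongr π)).trans (finSuccEquiv' j).symm

lemma sign_extendPerm {n : ℕ} (j : Fin (n + 1)) (π : Equiv.Perm (Fin n)) :
    Equiv.Perm.sign (extendPerm j π) = Equiv.Perm.sign π := by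
  rw [extendPerm, Equiv.Perm.sign_symm_trans_trans, Equiv.optionCongr_sign]

lemma ins_comp_perm {α : Type*} {n : ℕ} (j : Fin (n + 1)) (π : Equiv.Perm (Fin n)) (a : α)
    (v : Fin n → α) : ins j a (fun i => v (π i)) = fun i => ins j a v (extendPerm j π i) := by
  ext l
  rcases Fin.eq_self_or_eq_succAbove j l with rfl | ⟨l, rfl⟩ <;> simp [extendPerm]

/-- The function of the remaining particles when the `j`-th particle is at `(y, τ)`. -/
def slice {n : ℕ} (j : Fin (n + 1)) (y : Fin 3 → ℝ) (τ : Fin 2)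
    (Φ : (Fin (n + 1) → Fin 3 → ℝ) → (Fin (n + 1) → Fin 2) → ℂ) :
    (Fin n → Fin 3 → ℝ) → (Fin n → Fin 2) → ℂ :=
  fun x s => Φ (ins j y x) (ins j τ s)

section Slice

variable {n : ℕ} {w θ : (Fin 3 → ℝ) → ℝ} {A : (Fin 3 → ℝ) → Fin 3 → ℝ}
  {Φ Ψ : (Fin (n + 1) → Fin 3 → ℝ) → (Fin (n + 1) → Fin 2) → ℂ} {B : ℝ}

lemma SmoothCompact.slice (h : SmoothCompact Φ) (j : Fin (n + 1)) (y : Fin 3 → ℝ) (τ : Fin 2) :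
    SmoothCompact (slice j y τ Φ) where
  smooth s := (h.smooth (ins j τ s)).comp (contDiff_ins j y)
  compactSupport s := by
    obtain ⟨R, hR⟩ := (h.compactSupport (ins j τ s)).isBounded.exists_norm_le
    refine HasCompactSupport.of_support_subset_isCompact
      (isCompact_closedBall (0 : Fin n → Fin 3 → ℝ) R) fun x hx => ?_
    rw [mem_closedBall_zero_iff]
    exact (norm_le_norm_ins j y x).trans (hR _ (subset_tsupport _ hx))

lemma Antisymm.slice_mul (ha : Antisymm Ψ) (F : (Fin 3 → ℝ) → ℝ) (j : Fin (n + 1))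
    (y : Fin 3 → ℝ) (τ : Fin 2) :
    Antisymm (slice j y τ fun x s => (F (x j) : ℂ) * Ψ x s) := by
  intro π x s
  simp only [slice, ins_self, ins_comp_perm, ha (extendPerm j π), sign_extendPerm]
  ring

lemma fderiv_comp_ins {f : (Fin (n + 1) → Fin 3 → ℝ) → ℂ} (hf : ContDiff ℝ (⊤ : ℕ∞) f)
    (j : Fin (n + 1)) (y : Fin 3 → ℝ) (x : Fin n → Fin 3 → ℝ) (i : Fin n) (k : Fin 3) :
    fderiv ℝ (fun x' => f (ins j y x')) x (eVec n i k) =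
      fderiv ℝ f (ins j y x) (eVec (n + 1) (j.succAbove i) k) := by
  have hg : Differentiable ℝ fun x' => f (ins j y x') :=
    (hf.comp (contDiff_ins j y)).differentiable (by simp)
  rw [← (hf.differentiable (by simp) _).lineDeriv_eq_fderiv, ← (hg x).lineDeriv_eq_fderiv]
  simp only [lineDeriv, ins_add_smul]

lemma pauliDiff_ins (h : SmoothCompact Φ) (j : Fin (n + 1)) (i : Fin n) (y : Fin 3 → ℝ)
    (τ : Fin 2) (x : Fin n → Fin 3 → ℝ) (s : Fin n → Fin 2) :
    pauliDiff (n + 1) A (j.succAbove i) Φ (ins j y x) (ins j τ s) =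
      pauliDiff n A i (slice j y τ Φ) x s := by
  simp only [pauliDiff, ins_succAbove, ins_update, slice, fderiv_comp_ins (h.smooth _)]

/-- The part of the energy density that involves the `j`-th particle. -/
def partDens {N : ℕ} (w θ : (Fin 3 → ℝ) → ℝ) (A : (Fin 3 → ℝ) → Fin 3 → ℝ) (j : Fin N)
    (Φ : (Fin N → Fin 3 → ℝ) → (Fin N → Fin 2) → ℂ) (x : Fin N → Fin 3 → ℝ)
    (s : Fin N → Fin 2) : ℝ :=
  ‖pauliDiff N A j (cutMul N θ j Φ) x s‖ ^ 2 - w (x j) * ‖Φ x s‖ ^ 2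
    + ∑ i, (enorm3 (x j - x i))⁻¹ * ‖Φ x s‖ ^ 2

lemma SmoothCompact.spinIntegrable_partDens {N : ℕ}
    {Φ : (Fin N → Fin 3 → ℝ) → (Fin N → Fin 2) → ℂ} (h : SmoothCompact Φ) (hw : Measurable w)
    (hB : ∀ y, |w y| ≤ B) (hθ : ContDiff ℝ (⊤ : ℕ∞) θ) (hA : Continuous A) (j : Fin N) :
    SpinIntegrable (partDens w θ A j Φ) := by
  refine (((h.cutMul hθ j).spinIntegrable_pauliDiff hA j).sub
    (h.spinIntegrable_onePot hw hB j)).add (SpinIntegrable.sum _ fun i => ?_)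
  simpa using h.spinIntegrable_inv_mul continuous_const (F := fun _ => 1) j i

lemma coulomb_ins (j : Fin (n + 1)) (y : Fin 3 → ℝ) (x : Fin n → Fin 3 → ℝ) :
    coulomb (ins j y x) = coulomb x + ∑ i, (enorm3 (y - x i))⁻¹ := by
  simp only [coulomb, Fin.sum_univ_succAbove _ j, ins_self, ins_succAbove, sub_self, enorm3_zero,
    inv_zero, zero_add, Finset.sum_add_distrib]
  simp only [fun i => enorm3_sub_comm (x i) y]
  ring

lemma enDens_ins (h : SmoothCompact Φ) (hθ : ContDiff ℝ (⊤ : ℕ∞) θ) (j : Fin (n + 1))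
    (y : Fin 3 → ℝ) (τ : Fin 2) (x : Fin n → Fin 3 → ℝ) (s : Fin n → Fin 2) :
    enDens w θ A Φ (ins j y x) (ins j τ s) - partDens w θ A j Φ (ins j y x) (ins j τ s) =
      enDens w θ A (slice j y τ Φ) x s := by
  have hcut : ∀ i, slice j y τ (cutMul (n + 1) θ (j.succAbove i) Φ) =
      cutMul n θ i (slice j y τ Φ) := by
    intro i; funext x s; simp [slice, cutMul]
  simp only [enDens, partDens, Fin.sum_univ_succAbove _ j, ins_self, ins_succAbove,
    pauliDiff_ins (h.cutMul hθ _), hcut, coulomb_ins, sub_self, enorm3_zero, inv_zero, zero_mul,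
    zero_add, ← Finset.sum_mul]
  simp only [slice]
  ring

lemma mul_normSq_add_le_energy (h : SmoothCompact Φ) (hw : Measurable w)
    (hB : ∀ y, |w y| ≤ B) (hθ : ContDiff ℝ (⊤ : ℕ∞) θ) (hA : Continuous A) (j : Fin (n + 1))
    {e : ℝ} (he : ∀ y τ, e * normSq (slice j y τ Φ) ≤ energy w θ A (slice j y τ Φ)) :
    e * normSq Φ + spinInt (partDens w θ A j Φ) ≤ energy w θ A Φ := by
  have h1 := h.spinIntegrable_enDens hw hB hθ hA
  have h2 := h.spinIntegrable_partDens hw hB hθ hA j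
  have := spinInt_mono_ins (h.spinIntegrable_normSq.const_mul e) (h1.sub h2) j fun y τ => by
    simp only [enDens_ins h hθ, spinInt_const_mul]
    exact he y τ
  rw [spinInt_const_mul, spinInt_sub h1 h2] at this
  unfold normSq energy
  linarith

lemma energy_le_mul_normSq_add (h : SmoothCompact Φ) (hw : Measurable w)
    (hB : ∀ y, |w y| ≤ B) (hθ : ContDiff ℝ (⊤ : ℕ∞) θ) (hA : Continuous A) (j : Fin (n + 1))
    {e : ℝ} (he : ∀ y τ, energy w θ A (slice j y τ Φ) ≤ e * normSq (slice j y τ Φ)) :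
    energy w θ A Φ ≤ e * normSq Φ + spinInt (partDens w θ A j Φ) := by
  have h1 := h.spinIntegrable_enDens hw hB hθ hA
  have h2 := h.spinIntegrable_partDens hw hB hθ hA j
  have := spinInt_mono_ins (h1.sub h2) (h.spinIntegrable_normSq.const_mul e) j fun y τ => by
    simp only [enDens_ins h hθ, spinInt_const_mul]
    exact he y τ
  rw [spinInt_const_mul, spinInt_sub h1 h2] at this
  unfold normSq energy
  linarith

end Slice

/-! ### The localization weight -/

/-- The regularized distance to the origin. -/
def regDist (d : ℝ) (y : Fin 3 → ℝ) : ℝ := Real.sqrt (∑ k, y k ^ 2 + d ^ 2)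

/-- The bounded weight replacing `|y|`. -/
def weight (d ε : ℝ) (y : Fin 3 → ℝ) : ℝ := regDist d y / (1 + ε * regDist d y)

section Weight

variable {d ε : ℝ}

lemma sum_sq_add_sq_pos (hd : 0 < d) (y : Fin 3 → ℝ) : 0 < ∑ k, y k ^ 2 + d ^ 2 :=
  add_pos_of_nonneg_of_pos (Finset.sum_nonneg fun _ _ => sq_nonneg _) (by positivity)

lemma regDist_pos (hd : 0 < d) (y : Fin 3 → ℝ) : 0 < regDist d y :=
  Real.sqrt_pos.2 (sum_sq_add_sq_pos hd y)

lemma regDist_sq (hd : 0 < d) (y : Fin 3 → ℝ) : regDist d y ^ 2 = enorm3 y ^ 2 + d ^ 2 := by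
  rw [enorm3_sq]
  exact Real.sq_sqrt (sum_sq_add_sq_pos hd y).le

lemma le_regDist (hd : 0 < d) (y : Fin 3 → ℝ) : d ≤ regDist d y := by
  nlinarith [regDist_sq hd y, regDist_pos hd y, sq_nonneg (enorm3 y)]

lemma enorm3_le_regDist (hd : 0 < d) (y : Fin 3 → ℝ) : enorm3 y ≤ regDist d y := by
  nlinarith [regDist_sq hd y, regDist_pos hd y, enorm3_nonneg y]

lemma one_add_mul_regDist_pos (hd : 0 < d) (hε : 0 < ε) (y : Fin 3 → ℝ) :
    0 < 1 + ε * regDist d y := by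
  have := regDist_pos hd y
  positivity

lemma weight_pos (hd : 0 < d) (hε : 0 < ε) (y : Fin 3 → ℝ) : 0 < weight d ε y :=
  div_pos (regDist_pos hd y) (one_add_mul_regDist_pos hd hε y)

lemma weight_le_regDist (hd : 0 < d) (hε : 0 < ε) (y : Fin 3 → ℝ) :
    weight d ε y ≤ regDist d y :=
  div_le_self (regDist_pos hd y).le (by nlinarith [regDist_pos hd y])

lemma weight_le_inv (hd : 0 < d) (hε : 0 < ε) (y : Fin 3 → ℝ) : weight d ε y ≤ ε⁻¹ := by
  rw [weight, div_le_iff₀ (one_add_mul_regDist_pos hd hε y), mul_add,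
    inv_mul_cancel_left₀ hε.ne']
  have := inv_pos.2 hε
  linarith

lemma le_weight_add_weight (hd : 0 < d) (hε : 0 < ε) (x y : Fin 3 → ℝ) {ρ : ℝ}
    (hρ : ρ ≤ enorm3 (x - y)) (hρε : ε * ρ ≤ 1) : ρ / 2 ≤ weight d ε x + weight d ε y := by
  have hx := regDist_pos hd x
  have hy := regDist_pos hd y
  have h : ρ ≤ regDist d x + regDist d y := hρ.trans <|
    (enorm3_sub_le x y).trans (add_le_add (enorm3_le_regDist hd x) (enorm3_le_regDist hd y))
  set a := regDist d x with ha
  set b := regDist d y with hb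
  have h1 : a / (1 + ε * (a + b)) ≤ weight d ε x :=
    div_le_div_of_nonneg_left hx.le (one_add_mul_regDist_pos hd hε x) (by
      rw [← ha]; nlinarith)
  have h2 : b / (1 + ε * (a + b)) ≤ weight d ε y :=
    div_le_div_of_nonneg_left hy.le (one_add_mul_regDist_pos hd hε y) (by
      rw [← hb]; nlinarith)
  refine le_trans ?_ (add_le_add h1 h2)
  rw [← add_div, div_le_div_iff₀ (by norm_num) (by positivity)]
  nlinarith [mul_le_mul_of_nonneg_right hρε (add_pos hx hy).le]

lemma contDiff_regDist (hd : 0 < d) : ContDiff ℝ (⊤ : ℕ∞) (regDist d) := by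
  unfold regDist
  refine ContDiff.sqrt ?_ fun y => (sum_sq_add_sq_pos hd y).ne'
  fun_prop

lemma contDiff_weight (hd : 0 < d) (hε : 0 < ε) : ContDiff ℝ (⊤ : ℕ∞) (weight d ε) :=
  (contDiff_regDist hd).div (contDiff_const.add (contDiff_const.mul (contDiff_regDist hd)))
    fun y => (one_add_mul_regDist_pos hd hε y).ne'

lemma fderiv_sqrt_apply {E : Type*} [NormedAddCommGroup E] [NormedSpace ℝ E] {u : E → ℝ} {x : E}
    (hu : DifferentiableAt ℝ u x) (hx : 0 < u x) (v : E) :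
    fderiv ℝ (fun y => Real.sqrt (u y)) x v = fderiv ℝ u x v / (2 * Real.sqrt (u x)) := by
  rw [(hu.hasFDerivAt.sqrt hx.ne').fderiv]
  simp only [_root_.smul_apply, smul_eq_mul]
  ring

lemma fderiv_regDist (hd : 0 < d) (y : Fin 3 → ℝ) (k : Fin 3) :
    fderiv ℝ (regDist d) y (Pi.single k 1) = y k / regDist d y := by
  have h : HasFDerivAt (fun y : Fin 3 → ℝ => ∑ k, y k ^ 2 + d ^ 2)
      (∑ k, (2 * y k) • ContinuousLinearMap.proj (R := ℝ) (φ := fun _ : Fin 3 => ℝ) k) y := by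
    have := (HasFDerivAt.fun_sum (u := Finset.univ) fun (k : Fin 3) _ =>
      (hasFDerivAt_apply (𝕜 := ℝ) (F' := fun _ : Fin 3 => ℝ) k y).pow 2).add_const (d ^ 2)
    simpa using this
  have h2 := fderiv_sqrt_apply h.differentiableAt (sum_sq_add_sq_pos hd y) (Pi.single k 1)
  rw [h.fderiv] at h2
  refine h2.trans ?_
  have h3 : (∑ k, (2 * y k) • ContinuousLinearMap.proj (R := ℝ) (φ := fun _ : Fin 3 => ℝ) k)
      (Pi.single k 1) = 2 * y k := by
    simp [_root_.sum_apply, Pi.single_apply]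
  rw [h3, regDist, mul_div_mul_left _ _ two_ne_zero]

lemma fderiv_weight (hd : 0 < d) (hε : 0 < ε) (y : Fin 3 → ℝ) (k : Fin 3) :
    fderiv ℝ (weight d ε) y (Pi.single k 1) =
      y k / regDist d y / (1 + ε * regDist d y) ^ 2 := by
  have hs := ((contDiff_regDist hd).differentiable (by simp) y).hasFDerivAt
  have hf : HasDerivAt (fun s : ℝ => s / (1 + ε * s)) (1 / (1 + ε * regDist d y) ^ 2)
      (regDist d y) := by
    have h1 : HasDerivAt (fun s : ℝ => 1 + ε * s) ε (regDist d y) := by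
      simpa using ((hasDerivAt_id (regDist d y)).const_mul ε).const_add 1
    refine ((hasDerivAt_id' (regDist d y)).fun_div h1
      (one_add_mul_regDist_pos hd hε y).ne').congr_deriv ?_
    ring
  have := (hf.comp_hasFDerivAt y hs).fderiv
  have h2 : fderiv ℝ (weight d ε) y = (1 / (1 + ε * regDist d y) ^ 2) • fderiv ℝ (regDist d) y :=
    this
  rw [h2]
  simp only [_root_.smul_apply, smul_eq_mul, fderiv_regDist hd]
  ring

lemma sum_fderiv_weight_sq (hd : 0 < d) (hε : 0 < ε) (y : Fin 3 → ℝ) :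
    ∑ k, fderiv ℝ (weight d ε) y (Pi.single k 1) ^ 2 =
      enorm3 y ^ 2 / regDist d y ^ 2 / (1 + ε * regDist d y) ^ 4 := by
  simp only [fderiv_weight hd hε, div_pow, ← Finset.sum_div, enorm3_sq]
  ring

lemma enorm3_sq_div_le_one (hd : 0 < d) (y : Fin 3 → ℝ) :
    enorm3 y ^ 2 / regDist d y ^ 2 ≤ 1 :=
  div_le_one_of_le₀ (pow_le_pow_left₀ (enorm3_nonneg y) (enorm3_le_regDist hd y) 2) (sq_nonneg _)

lemma sum_fderiv_weight_sq_le (hd : 0 < d) (hε : 0 < ε) (y : Fin 3 → ℝ) :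
    ∑ k, fderiv ℝ (weight d ε) y (Pi.single k 1) ^ 2 ≤ 1 := by
  rw [sum_fderiv_weight_sq hd hε]
  refine (div_le_self (by positivity) (one_le_pow₀ ?_)).trans (enorm3_sq_div_le_one hd y)
  nlinarith [regDist_pos hd y]

lemma sum_fderiv_sqrt_weight_sq_le (hd : 0 < d) (hε : 0 < ε) (y : Fin 3 → ℝ) :
    ∑ k, fderiv ℝ (fun y => Real.sqrt (weight d ε y)) y (Pi.single k 1) ^ 2 ≤ 1 / (4 * d) := by
  have hw := weight_pos hd hε y
  simp only [fderiv_sqrt_apply ((contDiff_weight hd hε).differentiable (by simp) y) hw, div_pow,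
    ← Finset.sum_div, sum_fderiv_weight_sq hd hε, mul_pow, Real.sq_sqrt hw.le]
  have hs := regDist_pos hd y
  have h1 := one_add_mul_regDist_pos hd hε y
  have h2 : 1 ≤ 1 + ε * regDist d y := by nlinarith
  have h3 : enorm3 y ^ 2 / regDist d y ^ 2 / (1 + ε * regDist d y) ^ 4 / (2 ^ 2 * weight d ε y) =
      enorm3 y ^ 2 / regDist d y ^ 2 * (1 / ((1 + ε * regDist d y) ^ 3 * (4 * regDist d y))) := by
    rw [weight]
    field_simp
    norm_num
  rw [h3]
  refine (mul_le_of_le_one_left (by positivity) (enorm3_sq_div_le_one hd y)).trans ?_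
  refine one_div_le_one_div_of_le (by positivity) ?_
  have := le_regDist hd y
  nlinarith [one_le_pow₀ (n := 3) h2, mul_le_mul_of_nonneg_right (one_le_pow₀ (n := 3) h2)
    (by positivity : 0 ≤ 4 * regDist d y)]

end Weight

/-! ### Repulsion beats attraction -/

lemma ae_injective (N : ℕ) :
    ∀ᵐ x : Fin N → Fin 3 → ℝ, ∀ i j, i ≠ j → x i ≠ x j := by
  refine ae_all_iff.2 fun i => ae_all_iff.2 fun j => ?_
  by_cases hij : i = j
  · simp [hij]
  let S : Submodule ℝ (Fin N → Fin 3 → ℝ) :=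
    LinearMap.ker (LinearMap.proj (R := ℝ) (φ := fun _ : Fin N => Fin 3 → ℝ) i -
      LinearMap.proj j)
  have hS : S ≠ ⊤ := by
    intro h
    have hmem : (Pi.single i 1 : Fin N → Fin 3 → ℝ) ∈ S := h ▸ Submodule.mem_top
    have := congrFun (LinearMap.mem_ker.1 hmem) 0
    simp [Pi.single_eq_of_ne (Ne.symm hij)] at this
  have h0 := Measure.addHaar_submodule (volume : Measure (Fin N → Fin 3 → ℝ)) S hS
  filter_upwards [measure_eq_zero_iff_ae_notMem.1 h0] with x hx _ hxx
  exact hx (by simp [S, hxx])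

lemma le_repulsion {N : ℕ} {d ε η M : ℝ} (hd : 0 < d) (hε : 0 < ε) (hη : 0 ≤ η)
    (hM1 : M ≤ N * (N - 1) / 4) (hM2 : M ≤ η * (ε⁻¹ / 2)) {x : Fin N → Fin 3 → ℝ}
    (hx : ∀ i j, i ≠ j → x i ≠ x j) :
    M ≤ η * ∑ j, weight d ε (x j) + ∑ j, ∑ i, (enorm3 (x j - x i))⁻¹ * weight d ε (x j) := by
  have hw := fun j => (weight_pos hd hε (x j)).le
  have hinv := fun i j => inv_nonneg.2 (enorm3_nonneg (x i - x j))
  by_cases hfar : ∃ i j, ε⁻¹ < enorm3 (x i - x j)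
  · obtain ⟨i, j, hij⟩ := hfar
    have hne : i ≠ j := by
      rintro rfl
      rw [sub_self, enorm3_zero] at hij
      exact absurd hij (inv_pos.2 hε).not_gt
    have h1 := le_weight_add_weight hd hε (x i) (x j) hij.le
      (mul_inv_cancel₀ hε.ne').le
    have h2 : weight d ε (x i) + weight d ε (x j) ≤ ∑ j, weight d ε (x j) := by
      rw [← Finset.sum_pair hne (f := fun j => weight d ε (x j))]
      exact Finset.sum_le_sum_of_subset_of_nonneg (Finset.subset_univ _) fun l _ _ => hw l
    have h3 := mul_le_mul_of_nonneg_left (h1.trans h2) hη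
    have h4 : 0 ≤ ∑ j, ∑ i, (enorm3 (x j - x i))⁻¹ * weight d ε (x j) :=
      Finset.sum_nonneg fun j _ => Finset.sum_nonneg fun i _ => mul_nonneg (hinv j i) (hw j)
    linarith
  · push Not at hfar
    have hsym : ∑ j, ∑ i, (enorm3 (x j - x i))⁻¹ * weight d ε (x j) =
        1 / 2 * ∑ j, ∑ i, (enorm3 (x j - x i))⁻¹ * (weight d ε (x j) + weight d ε (x i)) := by
      have : ∑ j, ∑ i, (enorm3 (x j - x i))⁻¹ * weight d ε (x i) =
          ∑ j, ∑ i, (enorm3 (x j - x i))⁻¹ * weight d ε (x j) := by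
        rw [Finset.sum_comm]
        exact Finset.sum_congr rfl fun j _ => Finset.sum_congr rfl fun i _ => by
          rw [enorm3_sub_comm]
      simp only [mul_add, Finset.sum_add_distrib, this]
      ring
    have hpair : ∀ j i, (if j = i then 0 else 1 / 2 : ℝ) ≤
        (enorm3 (x j - x i))⁻¹ * (weight d ε (x j) + weight d ε (x i)) := by
      intro j i
      split_ifs with h
      · exact mul_nonneg (hinv j i) (add_nonneg (hw j) (hw i))
      · have hpos : 0 < enorm3 (x j - x i) := enorm3_pos (sub_ne_zero.2 (hx j i h))
        have h1 := le_weight_add_weight hd hε (x j) (x i) le_rfl (by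
          calc ε * enorm3 (x j - x i) ≤ ε * ε⁻¹ := by gcongr; exact hfar j i
            _ = 1 := mul_inv_cancel₀ hε.ne')
        rw [inv_mul_eq_div, le_div_iff₀ hpos]
        linarith
    have hcount : ∑ j : Fin N, ∑ i : Fin N, (if j = i then 0 else 1 / 2 : ℝ) =
        N * (N - 1) / 2 := by
      have : ∀ j i : Fin N, (if j = i then 0 else 1 / 2 : ℝ) =
          1 / 2 - if j = i then 1 / 2 else 0 := fun j i => by split_ifs <;> norm_num
      simp only [this, Finset.sum_sub_distrib, Finset.sum_ite_eq, Finset.mem_univ, if_true,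
        Finset.sum_const, Finset.card_univ, Fintype.card_fin, nsmul_eq_mul]
      ring
    have h5 := Finset.sum_le_sum fun j (_ : j ∈ Finset.univ) =>
      Finset.sum_le_sum fun i (_ : i ∈ Finset.univ) => hpair j i
    rw [hcount] at h5
    rw [hsym]
    have h6 := mul_nonneg hη (Finset.sum_nonneg fun j (_ : j ∈ Finset.univ) => hw j)
    linarith

/-! ### Binding fails for large particle numbers -/

section Localization

variable {N : ℕ}

lemma fderiv_comp_coord {f : (Fin 3 → ℝ) → ℝ} {x : Fin N → Fin 3 → ℝ} {i : Fin N}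
    (hf : DifferentiableAt ℝ f (x i)) (j : Fin N) (k : Fin 3) :
    fderiv ℝ (fun x : Fin N → Fin 3 → ℝ => f (x i)) x (eVec N j k) =
      if i = j then fderiv ℝ f (x i) (Pi.single k 1) else 0 := by
  have h : HasFDerivAt (fun x : Fin N → Fin 3 → ℝ => f (x i))
      ((fderiv ℝ f (x i)).comp
        (ContinuousLinearMap.proj (R := ℝ) (φ := fun _ : Fin N => Fin 3 → ℝ) i)) x :=
    hf.hasFDerivAt.comp x (hasFDerivAt_apply (𝕜 := ℝ) (F' := fun _ : Fin N => Fin 3 → ℝ) i x)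
  rw [h.fderiv]
  rcases eq_or_ne i j with rfl | hij
  · simp [eVec]
  · simp [eVec, hij]

/-- The partition of unity localizing either no particle or one far-out particle. -/
def locPart (t : ℝ) (g : (Fin 3 → ℝ) → ℝ) : Option (Fin N) → (Fin N → Fin 3 → ℝ) → ℝ
  | none => fun x => Real.sqrt (1 - t * ∑ i, g (x i))
  | some j => fun x => Real.sqrt t * Real.sqrt (g (x j))

variable {t : ℝ} {g : (Fin 3 → ℝ) → ℝ}

lemma contDiff_locPart (hg : ContDiff ℝ (⊤ : ℕ∞) g) (hpos : ∀ y, 0 < g y)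
    (hle : ∀ x : Fin N → Fin 3 → ℝ, t * ∑ i, g (x i) ≤ 1 / 2) (o : Option (Fin N)) :
    ContDiff ℝ (⊤ : ℕ∞) (locPart t g o) := by
  have hgi : ∀ i, ContDiff ℝ (⊤ : ℕ∞) fun x : Fin N → Fin 3 → ℝ => g (x i) := fun i =>
    hg.comp (contDiff_apply ℝ (Fin 3 → ℝ) i)
  cases o with
  | none =>
    exact (contDiff_const.sub (contDiff_const.mul (ContDiff.sum fun i _ => hgi i))).sqrt
      fun x => by have := hle x; linarith
  | some j => exact contDiff_const.mul ((hgi j).sqrt fun x => (hpos _).ne')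

lemma sum_locPart_sq (ht : 0 ≤ t) (hpos : ∀ y, 0 < g y)
    (hle : ∀ x : Fin N → Fin 3 → ℝ, t * ∑ i, g (x i) ≤ 1 / 2) (x : Fin N → Fin 3 → ℝ) :
    ∑ o, locPart t g o x ^ 2 = 1 := by
  rw [Fintype.sum_option]
  simp only [locPart, mul_pow, Real.sq_sqrt ht, Real.sq_sqrt (hpos _).le, ← Finset.mul_sum]
  rw [Real.sq_sqrt (by have := hle x; linarith)]
  ring

lemma sum_partGrad_locPart_sq_le (ht : 0 ≤ t) (hg : ContDiff ℝ (⊤ : ℕ∞) g)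
    (hpos : ∀ y, 0 < g y) (hle : ∀ x : Fin N → Fin 3 → ℝ, t * ∑ i, g (x i) ≤ 1 / 2) {a b : ℝ}
    (ha : ∀ y, ∑ k, fderiv ℝ g y (Pi.single k 1) ^ 2 ≤ a)
    (hb : ∀ y, ∑ k, fderiv ℝ (fun y => Real.sqrt (g y)) y (Pi.single k 1) ^ 2 ≤ b)
    (j : Fin N) (x : Fin N → Fin 3 → ℝ) :
    ∑ o, ∑ k, partGrad j (locPart t g o) x k ^ 2 ≤ t ^ 2 * a / 2 + t * b := by
  have hgd : ∀ y, DifferentiableAt ℝ g y := fun y => hg.differentiable (by simp) y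
  have hgi : ∀ i, DifferentiableAt ℝ (fun x : Fin N → Fin 3 → ℝ => g (x i)) x := fun i =>
    (hg.comp (contDiff_apply ℝ (Fin 3 → ℝ) i)).differentiable (by simp) x
  rw [Fintype.sum_option]
  refine add_le_add ?_ ?_
  · have h1 := hle x
    have hd : DifferentiableAt ℝ (fun x : Fin N → Fin 3 → ℝ => 1 - t * ∑ i, g (x i)) x :=
      (differentiableAt_const _).sub ((differentiableAt_const _).mul
        (DifferentiableAt.fun_sum fun i _ => hgi i))
    have h2 : ∀ k, partGrad j (locPart t g none) x k =
        -(t * fderiv ℝ g (x j) (Pi.single k 1)) / (2 * Real.sqrt (1 - t * ∑ i, g (x i))) := by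
      intro k
      refine (fderiv_sqrt_apply hd (by linarith) _).trans ?_
      congr 1
      rw [fderiv_const_sub, fderiv_const_mul (DifferentiableAt.fun_sum fun i _ => hgi i),
        fderiv_fun_sum fun i _ => hgi i]
      simp [_root_.sum_apply, fderiv_comp_coord (hgd _)]
    have h3 : ∀ k, partGrad j (locPart t g none) x k ^ 2 ≤
        t ^ 2 / 2 * fderiv ℝ g (x j) (Pi.single k 1) ^ 2 := by
      intro k
      rw [h2, div_pow, mul_pow 2, Real.sq_sqrt (by linarith), neg_sq, mul_pow,
        div_le_iff₀ (by linarith)]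
      nlinarith [mul_nonneg (sq_nonneg t) (sq_nonneg (fderiv ℝ g (x j) (Pi.single k 1)))]
    calc _ ≤ ∑ k, t ^ 2 / 2 * fderiv ℝ g (x j) (Pi.single k 1) ^ 2 :=
          Finset.sum_le_sum fun k _ => h3 k
      _ = t ^ 2 / 2 * ∑ k, fderiv ℝ g (x j) (Pi.single k 1) ^ 2 := by rw [Finset.mul_sum]
      _ ≤ t ^ 2 / 2 * a := by gcongr; exact ha _
      _ = t ^ 2 * a / 2 := by ring
  · have hsd : ∀ y, DifferentiableAt ℝ (fun y => Real.sqrt (g y)) y := fun y =>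
      (hgd y).sqrt (hpos y).ne'
    have h2 : ∀ i k, partGrad j (locPart t g (some i)) x k =
        if i = j then Real.sqrt t * fderiv ℝ (fun y => Real.sqrt (g y)) (x i) (Pi.single k 1)
        else 0 := by
      intro i k
      have h3 : DifferentiableAt ℝ (fun x : Fin N → Fin 3 → ℝ => Real.sqrt (g (x i))) x :=
        (hgi i).sqrt (hpos _).ne'
      simp only [partGrad, locPart]
      rw [fderiv_const_mul h3, _root_.smul_apply, smul_eq_mul,
        fderiv_comp_coord (f := fun y => Real.sqrt (g y)) (hsd _), mul_ite, mul_zero]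
    have h4 : ∑ i, ∑ k, partGrad j (locPart t g (some i)) x k ^ 2 =
        t * ∑ k, fderiv ℝ (fun y => Real.sqrt (g y)) (x j) (Pi.single k 1) ^ 2 := by
      simp only [h2, ite_pow, mul_pow, Real.sq_sqrt ht, ne_eq, OfNat.ofNat_ne_zero,
        not_false_eq_true, zero_pow]
      rw [Finset.sum_comm, Finset.mul_sum]
      exact Finset.sum_congr rfl fun k _ => by simp
    rw [h4]
    exact mul_le_mul_of_nonneg_left (hb _) ht

end Localization

/-- If a particle can be bound with energy gain, the ground state energy is not the infimum. -/
lemma exists_add_le_energy {n : ℕ} {w θ : (Fin 3 → ℝ) → ℝ} {A : (Fin 3 → ℝ) → Fin 3 → ℝ}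
    {B d L e e' : ℝ} (hw : Measurable w) (hB : ∀ y, |w y| ≤ B) (hw0 : ∀ y, 0 ≤ w y)
    (hθ : ContDiff ℝ (⊤ : ℕ∞) θ) (hθ1 : ∀ y, |θ y| ≤ 1) (hA : Continuous A) (hd : 0 < d)
    (hL : ∀ y, w y * regDist d y ≤ L) (hn : L + 1 / (2 * d) + 2 ≤ n / 4)
    (he : ∀ Ψ, IsWaveFun (n + 1) Ψ → e ≤ energy w θ A Ψ)
    (he' : ∀ Ψ, IsWaveFun n Ψ → e' ≤ energy w θ A Ψ) (hlt : e < e') :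
    ∃ κ > 0, ∀ Ψ, IsWaveFun (n + 1) Ψ → e + κ ≤ energy w θ A Ψ := by
  have hL0 : 0 ≤ L := (mul_nonneg (hw0 0) (regDist_pos hd 0).le).trans (hL 0)
  obtain ⟨η, hη⟩ : ∃ η, η = e' - e := ⟨_, rfl⟩
  have hη0 : 0 < η := by linarith
  obtain ⟨M, hM⟩ : ∃ M : ℝ, M = (n + 1 : ℝ) * (L + 1 / (2 * d) + 2) := ⟨_, rfl⟩
  have hM0 : 0 < M := by rw [hM]; positivity
  obtain ⟨ε, hεdef⟩ : ∃ ε, ε = η / (2 * M) := ⟨_, rfl⟩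
  have hε : 0 < ε := by rw [hεdef]; positivity
  obtain ⟨t, htdef⟩ : ∃ t : ℝ, t = 1 / (2 * (n + 1) * ε⁻¹ + 1) := ⟨_, rfl⟩
  have hK : 0 < ε⁻¹ := inv_pos.2 hε
  have ht : 0 < t := by rw [htdef]; positivity
  have ht1 : t * (2 * (n + 1) * ε⁻¹ + 1) = 1 := by
    rw [htdef, one_div, inv_mul_cancel₀ (by positivity)]
  have ht2 : t ≤ 1 := by
    rw [htdef]
    exact div_le_one_of_le₀ (by nlinarith [mul_pos (by positivity : (0 : ℝ) < 2 * (n + 1)) hK])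
      (by positivity)
  have hpos := weight_pos hd hε
  have hle : ∀ x : Fin (n + 1) → Fin 3 → ℝ, t * ∑ i, weight d ε (x i) ≤ 1 / 2 := by
    intro x
    have h1 : ∑ i, weight d ε (x i) ≤ (n + 1) * ε⁻¹ := by
      calc _ ≤ ∑ _i : Fin (n + 1), ε⁻¹ := Finset.sum_le_sum fun i _ => weight_le_inv hd hε _
        _ = _ := by simp
    nlinarith
  refine ⟨t * (n + 1), by positivity, fun Ψ hΨ => ?_⟩
  have h := hΨ.smoothCompact
  have ha : Antisymm Ψ := hΨ.antisymm
  have hJ := contDiff_locPart (contDiff_weight hd hε) hpos hle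
  have hJs := fun o => h.real_mul (hJ o)
  have h1 := sum_locPart_sq ht.le hpos hle
  have hloc := sum_energy_le h hw hB hθ hθ1 hA hJ h1 (by positivity)
    (sum_partGrad_locPart_sq_le ht.le (contDiff_weight hd hε) hpos hle
      (sum_fderiv_weight_sq_le hd hε) (sum_fderiv_sqrt_weight_sq_le hd hε))
  rw [hΨ.normSq_eq, Fintype.sum_option] at hloc
  have hnone : e * normSq (fun x s => (locPart t (weight d ε) none x : ℂ) * Ψ x s) ≤
      energy w θ A fun x s => (locPart t (weight d ε) none x : ℂ) * Ψ x s := by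
    refine mul_normSq_le_energy he (hJs none) (fun π x s => ?_) hw hB hθ hA
    simp only [ha π x s, locPart, Equiv.sum_comp π fun i => weight d ε (x i)]
    ring
  have hsome : ∀ j, e' * normSq (fun x s => (locPart t (weight d ε) (some j) x : ℂ) * Ψ x s) +
      spinInt (partDens w θ A j fun x s => (locPart t (weight d ε) (some j) x : ℂ) * Ψ x s) ≤
      energy w θ A fun x s => (locPart t (weight d ε) (some j) x : ℂ) * Ψ x s := fun j =>
    mul_normSq_add_le_energy (hJs _) hw hB hθ hA j fun y τ =>
      mul_normSq_le_energy he' ((hJs _).slice j y τ)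
        (ha.slice_mul (fun y => Real.sqrt t * Real.sqrt (weight d ε y)) j y τ) hw hB hθ hA
  have hnorm : normSq (fun x s => (locPart t (weight d ε) none x : ℂ) * Ψ x s) +
      ∑ j, normSq (fun x s => (locPart t (weight d ε) (some j) x : ℂ) * Ψ x s) = 1 := by
    rw [← Fintype.sum_option fun o => normSq fun x s => (locPart t (weight d ε) o x : ℂ) * Ψ x s]
    unfold normSq
    rw [← spinInt_sum _ fun o => (hJs o).spinIntegrable_normSq, ← hΨ.normSq_eq]
    unfold normSq
    congr 1
    funext x s
    simp only [norm_mul, mul_pow, Complex.norm_real, Real.norm_eq_abs, sq_abs, ← Finset.sum_mul,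
      h1, one_mul]
  have hdens : t * (M - (n + 1) * L) ≤
      ∑ j, (η * normSq (fun x s => (locPart t (weight d ε) (some j) x : ℂ) * Ψ x s) +
      spinInt (partDens w θ A j fun x s =>
        (locPart t (weight d ε) (some j) x : ℂ) * Ψ x s)) := by
    have i1 := fun j => (hJs (some j)).spinIntegrable_normSq.const_mul η
    have i2 := fun j => (hJs (some j)).spinIntegrable_partDens hw hB hθ hA j
    have h3 : ∀ j, η * normSq (fun x s => (locPart t (weight d ε) (some j) x : ℂ) * Ψ x s) +
        spinInt (partDens w θ A j fun x s =>
          (locPart t (weight d ε) (some j) x : ℂ) * Ψ x s) = _ := fun j => by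
      rw [normSq, ← spinInt_const_mul, ← spinInt_add (i1 j) (i2 j)]
    simp only [h3]
    rw [← spinInt_sum _ fun j => (i1 j).add (i2 j),
      show t * (M - (n + 1) * L) = t * (M - (n + 1) * L) * normSq Ψ by
        rw [hΨ.normSq_eq, mul_one], normSq, ← spinInt_const_mul]
    refine spinInt_mono (h.spinIntegrable_normSq.const_mul _)
      (SpinIntegrable.sum _ fun j => (i1 j).add (i2 j)) ?_
    filter_upwards [ae_injective (n + 1)] with x hx s
    have hM1 : M ≤ (n + 1 : ℕ) * ((n + 1 : ℕ) - 1) / 4 := by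
      rw [hM]
      push_cast
      nlinarith
    have hM2 : M ≤ η * (ε⁻¹ / 2) := by
      rw [hεdef]
      apply le_of_eq
      field_simp
    have hrep := le_repulsion hd hε hη0.le hM1 hM2 hx
    have hterm : ∀ j, t * (η * weight d ε (x j) - L +
        ∑ i, (enorm3 (x j - x i))⁻¹ * weight d ε (x j)) * ‖Ψ x s‖ ^ 2 ≤
        η * ‖(locPart t (weight d ε) (some j) x : ℂ) * Ψ x s‖ ^ 2 +
        partDens w θ A j (fun x s => (locPart t (weight d ε) (some j) x : ℂ) * Ψ x s) x s := by
      intro j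
      have hsq : ‖(locPart t (weight d ε) (some j) x : ℂ) * Ψ x s‖ ^ 2 =
          t * weight d ε (x j) * ‖Ψ x s‖ ^ 2 := by
        simp only [locPart, norm_mul, mul_pow, Complex.norm_real, Real.norm_eq_abs, sq_abs,
          Real.sq_sqrt ht.le, Real.sq_sqrt (hpos _).le]
      have hwL : w (x j) * weight d ε (x j) ≤ L :=
        (mul_le_mul_of_nonneg_left (weight_le_regDist hd hε _) (hw0 _)).trans (hL _)
      simp only [partDens, hsq, ← Finset.sum_mul]
      have := mul_le_mul_of_nonneg_left hwL (mul_nonneg ht.le (sq_nonneg ‖Ψ x s‖))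
      have := sq_nonneg ‖pauliDiff (n + 1) A j (cutMul (n + 1) θ j
        fun x s => (locPart t (weight d ε) (some j) x : ℂ) * Ψ x s) x s‖
      nlinarith
    refine le_trans ?_ (Finset.sum_le_sum fun j _ => hterm j)
    rw [← Finset.sum_mul, ← Finset.mul_sum]
    refine mul_le_mul_of_nonneg_right (mul_le_mul_of_nonneg_left ?_ ht.le) (sq_nonneg _)
    rw [Finset.sum_add_distrib, Finset.sum_sub_distrib, ← Finset.mul_sum]
    simp only [Finset.sum_const, Finset.card_univ, Fintype.card_fin, nsmul_eq_mul]
    push_cast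
    linarith
  have hsum := Finset.sum_le_sum fun j (_ : j ∈ Finset.univ) => hsome j
  rw [Finset.sum_add_distrib, ← Finset.mul_sum] at hsum hdens
  have hfin : t * (M - (n + 1) * L) - 2 * ((n + 1 : ℕ) : ℝ) * (t ^ 2 * 1 / 2 + t * (1 / (4 * d))) * 1
      ≥ t * (n + 1) := by
    have : (1 : ℝ) / (2 * d) = 2 * (1 / (4 * d)) := by field_simp; norm_num
    rw [hM, this]
    push_cast
    have h5 : 0 ≤ (n + 1) * (t * (1 - t)) := by
      have : 0 ≤ 1 - t := by linarith
      positivity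
    nlinarith
  have he'' : e' = e + η := by linarith
  rw [he''] at hsum
  set S := ∑ j, normSq (fun x s => (locPart t (weight d ε) (some j) x : ℂ) * Ψ x s)
  have hsplit := congrArg (e * ·) hnorm
  simp only [mul_add, mul_one] at hsplit
  linarith

/-! ### Adding a particle -/

/-- The product of a one-particle function in the `j`-th variable with a function of the others. -/
def tensorAt {n : ℕ} (j : Fin (n + 1)) (f : (Fin 3 → ℝ) → Fin 2 → ℂ)
    (Ψ : (Fin n → Fin 3 → ℝ) → (Fin n → Fin 2) → ℂ) :
    (Fin (n + 1) → Fin 3 → ℝ) → (Fin (n + 1) → Fin 2) → ℂ :=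
  fun x s => f (x j) (s j) * Ψ (fun i => x (j.succAbove i)) (fun i => s (j.succAbove i))

/-- The antisymmetric product of a one-particle function with an antisymmetric function. -/
def wedge {n : ℕ} (f : (Fin 3 → ℝ) → Fin 2 → ℂ)
    (Ψ : (Fin n → Fin 3 → ℝ) → (Fin n → Fin 2) → ℂ) :
    (Fin (n + 1) → Fin 3 → ℝ) → (Fin (n + 1) → Fin 2) → ℂ :=
  fun x s => ∑ j : Fin (n + 1), (-1 : ℂ) ^ (j : ℕ) * tensorAt j f Ψ x s

section Wedge

variable {n : ℕ} {f : (Fin 3 → ℝ) → Fin 2 → ℂ}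
  {Ψ : (Fin n → Fin 3 → ℝ) → (Fin n → Fin 2) → ℂ}

lemma swap_succAbove_castSucc (i l : Fin n) :
    Equiv.swap i.castSucc i.succ (i.castSucc.succAbove l) = i.succ.succAbove l := by
  simp only [Fin.succAbove, Equiv.swap_apply_def, Fin.ext_iff, Fin.lt_def]
  split_ifs <;> simp_all <;> omega

lemma tensorAt_swap (ha : Antisymm Ψ) (i : Fin n) (j : Fin (n + 1))
    (x : Fin (n + 1) → Fin 3 → ℝ) (s : Fin (n + 1) → Fin 2) :
    (-1 : ℂ) ^ (j : ℕ) * tensorAt j f Ψ (fun l => x (Equiv.swap i.castSucc i.succ l))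
        (fun l => s (Equiv.swap i.castSucc i.succ l)) =
      -((-1 : ℂ) ^ (Equiv.swap i.castSucc i.succ j : ℕ) *
        tensorAt (Equiv.swap i.castSucc i.succ j) f Ψ x s) := by
  have h2 : ∀ l, Equiv.swap i.castSucc i.succ (i.succ.succAbove l) = i.castSucc.succAbove l :=
    fun l => by rw [← swap_succAbove_castSucc, Equiv.swap_apply_self]
  by_cases h : j = i.castSucc
  · subst h
    simp only [tensorAt, swap_succAbove_castSucc, Equiv.swap_apply_left, Fin.val_castSucc,
      Fin.val_succ]
    ring
  by_cases h' : j = i.succ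
  · subst h'
    simp only [tensorAt, h2, Equiv.swap_apply_right, Fin.val_castSucc, Fin.val_succ]
    ring
  obtain ⟨a, ha'⟩ := Fin.exists_succAbove_eq (Ne.symm h)
  obtain ⟨b, hb'⟩ := Fin.exists_succAbove_eq (Ne.symm h')
  have hab : a ≠ b := by
    rintro rfl
    exact Fin.castSucc_lt_succ.ne (ha'.symm.trans hb')
  have h3 : ∀ l, Equiv.swap i.castSucc i.succ (j.succAbove l) =
      j.succAbove (Equiv.swap a b l) := fun l => by
    rw [← ha', ← hb', Fin.succAbove_right_injective.swap_apply]
  have h4 := ha (Equiv.swap a b) (fun l => x (j.succAbove l)) fun l => s (j.succAbove l)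
  simp only [tensorAt, h3, Equiv.swap_apply_of_ne_of_ne h h', h4, Equiv.Perm.sign_swap hab]
  push_cast
  ring

lemma tensorAt_perm (ha : Antisymm Ψ) (σ : Equiv.Perm (Fin (n + 1))) :
    ∀ (j : Fin (n + 1)) (x : Fin (n + 1) → Fin 3 → ℝ) (s : Fin (n + 1) → Fin 2),
    (-1 : ℂ) ^ (j : ℕ) * tensorAt j f Ψ (fun l => x (σ l)) (fun l => s (σ l)) =
      ((Equiv.Perm.sign σ : ℤ) : ℂ) * ((-1 : ℂ) ^ (σ j : ℕ) * tensorAt (σ j) f Ψ x s) := by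
  have hσ : σ ∈ Submonoid.closure
      (Set.range fun i : Fin n => Equiv.swap i.castSucc i.succ) := by
    rw [Equiv.Perm.mclosure_swap_castSucc_succ]
    exact Submonoid.mem_top σ
  induction hσ using Submonoid.closure_induction with
  | mem σ h =>
    obtain ⟨i, rfl⟩ := h
    intro j x s
    have := tensorAt_swap (f := f) ha i j x s
    simp only [Equiv.Perm.sign_swap Fin.castSucc_lt_succ.ne]
    push_cast
    rw [this]
    ring
  | one => intro j x s; simp
  | mul σ τ _ _ hs ht =>
    intro j x s
    have := ht j (fun l => x (σ l)) fun l => s (σ l)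
    simp only [Equiv.Perm.mul_apply, Equiv.Perm.sign_mul, Units.val_mul, Int.cast_mul]
    rw [this, hs]
    ring

lemma antisymm_wedge (ha : Antisymm Ψ) : Antisymm (wedge f Ψ) := by
  intro σ x s
  simp only [wedge, tensorAt_perm ha σ, ← Finset.mul_sum]
  rw [Equiv.sum_comp σ fun j => (-1 : ℂ) ^ (j : ℕ) * tensorAt j f Ψ x s]

lemma SmoothCompact.tensorAt (h : SmoothCompact Ψ) (hf : ∀ τ, ContDiff ℝ (⊤ : ℕ∞) fun y => f y τ)
    (hfc : ∀ τ, HasCompactSupport fun y => f y τ) (j : Fin (n + 1)) :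
    SmoothCompact (tensorAt j f Ψ) where
  smooth s := ((hf (s j)).comp (contDiff_apply ℝ (Fin 3 → ℝ) j)).mul
    ((h.smooth _).comp (contDiff_pi.2 fun i => contDiff_apply ℝ (Fin 3 → ℝ) (j.succAbove i)))
  compactSupport s := by
    obtain ⟨R₁, hR₁⟩ := (hfc (s j)).isBounded.exists_norm_le
    obtain ⟨R₂, hR₂⟩ :=
      (h.compactSupport fun i => s (j.succAbove i)).isBounded.exists_norm_le
    refine HasCompactSupport.of_support_subset_isCompact
      (isCompact_closedBall (0 : Fin (n + 1) → Fin 3 → ℝ) (max R₁ R₂)) fun x hx => ?_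
    have h1 := hR₁ (x j) (subset_tsupport _ (left_ne_zero_of_mul hx))
    have h2 := hR₂ (fun i => x (j.succAbove i)) (subset_tsupport _ (right_ne_zero_of_mul hx))
    rw [mem_closedBall_zero_iff,
      pi_norm_le_iff_of_nonneg ((norm_nonneg _).trans (h1.trans (le_max_left _ _)))]
    intro i
    rcases Fin.eq_self_or_eq_succAbove j i with rfl | ⟨i, rfl⟩
    · exact h1.trans (le_max_left _ _)
    · exact (norm_le_pi_norm (fun i => x (j.succAbove i)) i).trans (h2.trans (le_max_right _ _))

lemma slice_tensorAt (j : Fin (n + 1)) (y : Fin 3 → ℝ) (τ : Fin 2) :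
    slice j y τ (tensorAt j f Ψ) = fun x s => f y τ * Ψ x s := by
  funext x s
  simp [slice, tensorAt]

lemma normSq_tensorAt (h : SmoothCompact Ψ) (hf : ∀ τ, ContDiff ℝ (⊤ : ℕ∞) fun y => f y τ)
    (hfc : ∀ τ, HasCompactSupport fun y => f y τ) (j : Fin (n + 1)) :
    normSq (tensorAt j f Ψ) = (∑ τ, ∫ y, ‖f y τ‖ ^ 2) * normSq Ψ := by
  rw [normSq, spinInt_ins (h.tensorAt hf hfc j).spinIntegrable_normSq j, Finset.sum_mul]
  refine Finset.sum_congr rfl fun τ _ => ?_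
  rw [← integral_mul_const]
  refine integral_congr_ae (Filter.Eventually.of_forall fun y => ?_)
  have := normSq_const_mul (f y τ) (Ψ := Ψ)
  rw [← slice_tensorAt j] at this
  exact this

variable {w θ : (Fin 3 → ℝ) → ℝ} {A : (Fin 3 → ℝ) → Fin 3 → ℝ} {B : ℝ}

lemma energy_tensorAt_le (hΨ : IsWaveFun n Ψ) (hf : ∀ τ, ContDiff ℝ (⊤ : ℕ∞) fun y => f y τ)
    (hfc : ∀ τ, HasCompactSupport fun y => f y τ) (hw : Measurable w) (hB : ∀ y, |w y| ≤ B)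
    (hθ : ContDiff ℝ (⊤ : ℕ∞) θ) (hA : Continuous A) (j : Fin (n + 1)) :
    energy w θ A (tensorAt j f Ψ) ≤ energy w θ A Ψ * normSq (tensorAt j f Ψ) +
      spinInt (partDens w θ A j (tensorAt j f Ψ)) := by
  refine energy_le_mul_normSq_add (hΨ.smoothCompact.tensorAt hf hfc j) hw hB hθ hA j
    fun y τ => ?_
  rw [slice_tensorAt, energy_const_mul _ hΨ.smoothCompact hθ, normSq_const_mul, hΨ.normSq_eq,
    mul_one, mul_comm]

lemma enDens_eq_zero {N : ℕ} {Φ : (Fin N → Fin 3 → ℝ) → (Fin N → Fin 2) → ℂ}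
    {x : Fin N → Fin 3 → ℝ} (h : ∀ s, (fun y => Φ y s) =ᶠ[nhds x] fun _ => 0)
    (s : Fin N → Fin 2) : enDens w θ A Φ x s = 0 := by
  rw [enDens_congr (Φ := fun _ _ => 0) h s]
  simp [enDens, pauliDiff, cutMul]

end Wedge

section FarAway

variable {n : ℕ} {f : (Fin 3 → ℝ) → Fin 2 → ℂ} {φ : (Fin 3 → ℝ) → ℝ}
  {Ψ : (Fin n → Fin 3 → ℝ) → (Fin n → Fin 2) → ℂ} {R ℓ : ℝ}
  {w θ : (Fin 3 → ℝ) → ℝ} {A : (Fin 3 → ℝ) → Fin 3 → ℝ} {B : ℝ}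

lemma exists_forall_ne_tensorAt_eventuallyEq_zero (hR : ∀ x s, Ψ x s ≠ 0 → ‖x‖ ≤ R) (hℓ : 0 < ℓ)
    (hf : ∀ y τ, f y τ ≠ 0 → R + ℓ ≤ ‖y‖) (x : Fin (n + 1) → Fin 3 → ℝ) :
    ∃ j₀, ∀ j ≠ j₀, ∀ s, (fun y => tensorAt j f Ψ y s) =ᶠ[nhds x] fun _ => 0 := by
  by_cases hx : ∃ i, R < ‖x i‖
  · obtain ⟨i, hi⟩ := hx
    refine ⟨i, fun j hj s => ?_⟩
    obtain ⟨l, rfl⟩ := Fin.exists_succAbove_eq hj.symm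
    filter_upwards [((continuous_apply (j.succAbove l)).norm.tendsto x).eventually
      (lt_mem_nhds hi)] with y hy
    by_contra h0
    have := hR _ _ (right_ne_zero_of_mul h0)
    exact absurd ((norm_le_pi_norm (fun i => y (j.succAbove i)) l).trans this) hy.not_ge
  · push Not at hx
    refine ⟨0, fun j _ s => ?_⟩
    filter_upwards [((continuous_apply j).norm.tendsto x).eventually
      (gt_mem_nhds ((hx j).trans_lt (lt_add_of_pos_right R hℓ)))] with y hy
    by_contra h0
    exact absurd (hf _ _ (left_ne_zero_of_mul h0)) hy.not_ge

lemma normSq_wedge (h : SmoothCompact Ψ) (hfs : ∀ τ, ContDiff ℝ (⊤ : ℕ∞) fun y => f y τ)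
    (hfc : ∀ τ, HasCompactSupport fun y => f y τ) (hR : ∀ x s, Ψ x s ≠ 0 → ‖x‖ ≤ R) (hℓ : 0 < ℓ)
    (hf : ∀ y τ, f y τ ≠ 0 → R + ℓ ≤ ‖y‖) :
    normSq (wedge f Ψ) = ∑ j, normSq (tensorAt j f Ψ) := by
  unfold normSq
  rw [← spinInt_sum _ fun j => (h.tensorAt hfs hfc j).spinIntegrable_normSq]
  congr 1
  funext x s
  obtain ⟨j₀, hj₀⟩ := exists_forall_ne_tensorAt_eventuallyEq_zero hR hℓ hf x
  have h0 : ∀ j ≠ j₀, tensorAt j f Ψ x s = 0 := fun j hj => (hj₀ j hj s).eq_of_nhds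
  rw [wedge, Finset.sum_eq_single j₀ (fun j _ hj => by rw [h0 j hj, mul_zero]) (by simp),
    Finset.sum_eq_single j₀ (fun j _ hj => by simp [h0 j hj]) (by simp)]
  simp

lemma energy_wedge (h : SmoothCompact Ψ) (hfs : ∀ τ, ContDiff ℝ (⊤ : ℕ∞) fun y => f y τ)
    (hfc : ∀ τ, HasCompactSupport fun y => f y τ) (hR : ∀ x s, Ψ x s ≠ 0 → ‖x‖ ≤ R) (hℓ : 0 < ℓ)
    (hf : ∀ y τ, f y τ ≠ 0 → R + ℓ ≤ ‖y‖) (hw : Measurable w) (hB : ∀ y, |w y| ≤ B)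
    (hθ : ContDiff ℝ (⊤ : ℕ∞) θ) (hA : Continuous A) :
    energy w θ A (wedge f Ψ) = ∑ j, energy w θ A (tensorAt j f Ψ) := by
  unfold energy
  rw [← spinInt_sum _ fun j => (h.tensorAt hfs hfc j).spinIntegrable_enDens hw hB hθ hA]
  congr 1
  funext x s
  obtain ⟨j₀, hj₀⟩ := exists_forall_ne_tensorAt_eventuallyEq_zero hR hℓ hf x
  have hwedge : ∀ s, (fun y => wedge f Ψ y s) =ᶠ[nhds x]
      fun y => (-1 : ℂ) ^ (j₀ : ℕ) * tensorAt j₀ f Ψ y s := by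
    intro s
    have hall : ∀ᶠ y in nhds x, ∀ j ≠ j₀, tensorAt j f Ψ y s = 0 :=
      Filter.eventually_all.2 fun j => by
        by_cases hj : j = j₀
        · simp [hj]
        · exact (hj₀ j hj s).mono fun y hy _ => hy
    filter_upwards [hall] with y hy
    exact Finset.sum_eq_single j₀ (fun j _ hj => by rw [hy j hj, mul_zero]) (by simp)
  rw [enDens_congr hwedge, enDens_const_mul _ (h.tensorAt hfs hfc j₀) hθ,
    Finset.sum_eq_single j₀ (fun j _ hj => enDens_eq_zero (hj₀ j hj) s) (by simp)]
  simp

lemma norm_pauliDiff_tensorAt_sq_le (h : SmoothCompact Ψ) (hφ : ContDiff ℝ (⊤ : ℕ∞) φ)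
    (hAφ : ∀ y k, A y k * φ y = 0) {χ : Fin 2 → ℂ} (hχ : ∑ τ, ‖χ τ‖ ^ 2 ≤ 1) (j : Fin (n + 1))
    (x : Fin (n + 1) → Fin 3 → ℝ) (s : Fin (n + 1) → Fin 2) :
    ‖pauliDiff (n + 1) A j (tensorAt j (fun y τ => (φ y : ℂ) * χ τ) Ψ) x s‖ ^ 2 ≤
      ∑ k, ‖tensorAt j (fun y _ => (fderiv ℝ φ y (Pi.single k 1) : ℂ)) Ψ x s‖ ^ 2 := by
  set u : ℂ := Ψ (fun i => x (j.succAbove i)) (fun i => s (j.succAbove i)) with hu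
  have hrem : ContDiff ℝ (⊤ : ℕ∞)
      fun y : Fin (n + 1) → Fin 3 → ℝ => fun i : Fin n => y (j.succAbove i) :=
    contDiff_pi.2 fun i => contDiff_apply ℝ (Fin 3 → ℝ) (j.succAbove i)
  have hderiv : ∀ k t, fderiv ℝ (fun y => tensorAt j (fun y τ => (φ y : ℂ) * χ τ) Ψ y
      (Function.update s j t)) x (eVec (n + 1) j k) =
      (fderiv ℝ φ (x j) (Pi.single k 1) : ℂ) * (χ t * u) := by
    intro k t
    have hG : Differentiable ℝ fun y : Fin (n + 1) → Fin 3 → ℝ =>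
        χ t * Ψ (fun i => y (j.succAbove i)) fun i => s (j.succAbove i) :=
      (contDiff_const.mul ((h.smooth _).comp hrem)).differentiable (by simp)
    have hφj : DifferentiableAt ℝ (fun y : Fin (n + 1) → Fin 3 → ℝ => φ (y j)) x :=
      (hφ.comp (contDiff_apply ℝ (Fin 3 → ℝ) j)).differentiable (by simp) x
    have h1 := fderiv_ofReal_mul hφj (hG x) (eVec (n + 1) j k)
    have h2 : fderiv ℝ (fun y : Fin (n + 1) → Fin 3 → ℝ =>
        χ t * Ψ (fun i => y (j.succAbove i)) fun i => s (j.succAbove i)) x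
        (eVec (n + 1) j k) = 0 := by
      rw [← (hG x).lineDeriv_eq_fderiv]
      simp [lineDeriv, eVec]
    rw [h2, fderiv_comp_coord (hφ.differentiable (by simp) _), if_pos rfl, mul_zero, zero_add]
      at h1
    rw [← h1]
    congr 1
    congr 1
    funext y
    simp [tensorAt, mul_assoc]
  have hzero : ∀ k t, (A (x j) k : ℂ) * tensorAt j (fun y τ => (φ y : ℂ) * χ τ) Ψ x
      (Function.update s j t) = 0 := by
    intro k t
    have : (A (x j) k : ℂ) * (φ (x j) : ℂ) = 0 := by exact_mod_cast hAφ (x j) k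
    simp only [tensorAt, ← mul_assoc, this, zero_mul]
  have h1 := norm_pauli_sum_sq_le (s j) (fun k => fderiv ℝ φ (x j) (Pi.single k 1))
    fun t => -Complex.I * (χ t * u)
  have h2 : pauliDiff (n + 1) A j (tensorAt j (fun y τ => (φ y : ℂ) * χ τ) Ψ) x s =
      ∑ k, ∑ t, pauli k (s j) t * ((fderiv ℝ φ (x j) (Pi.single k 1) : ℂ) *
        (-Complex.I * (χ t * u))) := by
    simp only [pauliDiff, hderiv, hzero, add_zero]
    exact Finset.sum_congr rfl fun k _ => Finset.sum_congr rfl fun t _ => by ring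
  rw [h2]
  refine h1.trans ?_
  simp only [tensorAt, ← hu, norm_mul, norm_neg, Complex.norm_I, one_mul, mul_pow,
    Complex.norm_real, Real.norm_eq_abs, sq_abs, ← Finset.sum_mul]
  refine mul_le_mul_of_nonneg_left (mul_le_of_le_one_left (sq_nonneg _) hχ)
    (Finset.sum_nonneg fun k _ => sq_nonneg _)

lemma spinInt_partDens_tensorAt_le (h : IsWaveFun n Ψ) (hφ : ContDiff ℝ (⊤ : ℕ∞) φ)
    (hφc : HasCompactSupport φ) (hAφ : ∀ y k, A y k * φ y = 0) (hθφ : ∀ y, θ y * φ y = φ y)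
    {χ : Fin 2 → ℂ} (hχ : ∑ τ, ‖χ τ‖ ^ 2 = 1) (hR : ∀ x s, Ψ x s ≠ 0 → ‖x‖ ≤ R) (hℓ : 0 < ℓ)
    (hφR : ∀ y, φ y ≠ 0 → R + ℓ ≤ ‖y‖) (hw : Measurable w) (hB : ∀ y, |w y| ≤ B)
    (hw0 : ∀ y, 0 ≤ w y) (hθ : ContDiff ℝ (⊤ : ℕ∞) θ) (hA : Continuous A) (j : Fin (n + 1)) :
    spinInt (partDens w θ A j (tensorAt j (fun y τ => (φ y : ℂ) * χ τ) Ψ)) ≤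
      2 * (∑ k, ∫ y, fderiv ℝ φ y (Pi.single k 1) ^ 2) + (n + 1) / ℓ * ∫ y, φ y ^ 2 := by
  have hs := h.smoothCompact
  have hfs : ∀ τ, ContDiff ℝ (⊤ : ℕ∞) fun y => (φ y : ℂ) * χ τ := fun τ =>
    (Complex.ofRealCLM.contDiff.comp hφ).mul contDiff_const
  have hfc : ∀ τ, HasCompactSupport fun y => (φ y : ℂ) * χ τ := fun τ =>
    (hφc.comp_left (g := fun a : ℝ => (a : ℂ)) (by simp)).mul_right
  have hds : ∀ (k : Fin 3) (_ : Fin 2), ContDiff ℝ (⊤ : ℕ∞)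
      fun y => (fderiv ℝ φ y (Pi.single k 1) : ℂ) := fun k _ =>
    Complex.ofRealCLM.contDiff.comp
      ((hφ.fderiv_right (m := (⊤ : ℕ∞)) (by simp)).clm_apply contDiff_const)
  have hdc : ∀ (k : Fin 3) (_ : Fin 2), HasCompactSupport
      fun y => (fderiv ℝ φ y (Pi.single k 1) : ℂ) := fun k _ =>
    (hφc.fderiv_apply ℝ (Pi.single k 1)).comp_left (g := fun a : ℝ => (a : ℂ)) (by simp)
  have hcut : cutMul (n + 1) θ j (tensorAt j (fun y τ => (φ y : ℂ) * χ τ) Ψ) =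
      tensorAt j (fun y τ => (φ y : ℂ) * χ τ) Ψ := by
    funext x s
    have : (θ (x j) : ℂ) * (φ (x j) : ℂ) = φ (x j) := by exact_mod_cast hθφ (x j)
    simp only [cutMul, tensorAt, ← mul_assoc, this]
  have hS := hs.tensorAt hfs hfc j
  have i1 := fun k => (hs.tensorAt (hds k) (hdc k) j).spinIntegrable_normSq
  have i2 := hS.spinIntegrable_normSq.const_mul ((n + 1) / ℓ)
  have hbound : spinInt (partDens w θ A j (tensorAt j (fun y τ => (φ y : ℂ) * χ τ) Ψ)) ≤
      ∑ k, normSq (tensorAt j (fun y _ => (fderiv ℝ φ y (Pi.single k 1) : ℂ)) Ψ) +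
      (n + 1) / ℓ * normSq (tensorAt j (fun y τ => (φ y : ℂ) * χ τ) Ψ) := by
    unfold normSq
    rw [← spinInt_const_mul, ← spinInt_sum _ i1, ← spinInt_add (SpinIntegrable.sum _ i1) i2]
    refine spinInt_mono (hS.spinIntegrable_partDens hw hB hθ hA j)
      ((SpinIntegrable.sum _ i1).add i2) (Filter.Eventually.of_forall fun x s => ?_)
    have h1 := norm_pauliDiff_tensorAt_sq_le hs hφ hAφ hχ.le j x s
    have h2 := mul_nonneg (hw0 (x j))
      (sq_nonneg ‖tensorAt j (fun y τ => (φ y : ℂ) * χ τ) Ψ x s‖)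
    have h3 : ∑ i, (enorm3 (x j - x i))⁻¹ *
        ‖tensorAt j (fun y τ => (φ y : ℂ) * χ τ) Ψ x s‖ ^ 2 ≤
        (n + 1) / ℓ * ‖tensorAt j (fun y τ => (φ y : ℂ) * χ τ) Ψ x s‖ ^ 2 := by
      rcases eq_or_ne (tensorAt j (fun y τ => (φ y : ℂ) * χ τ) Ψ x s) 0 with h0 | h0
      · simp [h0]
      have hfar : R + ℓ ≤ ‖x j‖ := hφR _ fun hz => h0 (by simp [tensorAt, hz])
      have hnear := hR _ _ (right_ne_zero_of_mul h0)
      rw [← Finset.sum_mul]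
      refine mul_le_mul_of_nonneg_right ?_ (sq_nonneg _)
      calc ∑ i, (enorm3 (x j - x i))⁻¹ ≤ ∑ _i : Fin (n + 1), ℓ⁻¹ := by
            refine Finset.sum_le_sum fun i _ => ?_
            rcases Fin.eq_self_or_eq_succAbove j i with rfl | ⟨i, rfl⟩
            · simpa [enorm3_zero] using hℓ.le
            · refine inv_anti₀ hℓ (le_trans ?_ (norm_le_enorm3 _))
              have h4 := (norm_le_pi_norm (fun i => x (j.succAbove i)) i).trans hnear
              have h5 := norm_sub_norm_le (x j) (x (j.succAbove i))
              linarith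
        _ = (n + 1) / ℓ := by simp [div_eq_mul_inv]
    unfold partDens
    rw [hcut]
    linarith
  refine hbound.trans (le_of_eq ?_)
  simp only [normSq_tensorAt hs (hds _) (hdc _), normSq_tensorAt hs hfs hfc, h.normSq_eq, mul_one,
    norm_mul, mul_pow, Complex.norm_real, Real.norm_eq_abs, sq_abs, integral_mul_const,
    ← Finset.mul_sum, hχ]
  simp [Finset.mul_sum]

/-- Slowly varying normalized functions supported far away. -/
lemma exists_far_bump {ε : ℝ} (hε : 0 < ε) (R : ℝ) :
    ∃ φ : (Fin 3 → ℝ) → ℝ, ContDiff ℝ (⊤ : ℕ∞) φ ∧ HasCompactSupport φ ∧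
      (∀ y, φ y ≠ 0 → R ≤ ‖y‖) ∧ ∫ y, φ y ^ 2 = 1 ∧
      ∑ k, ∫ y, fderiv ℝ φ y (Pi.single k 1) ^ 2 ≤ ε := by
  let u : ContDiffBump (0 : Fin 3 → ℝ) := ⟨1, 2, one_pos, one_lt_two⟩
  have hus : ContDiff ℝ (⊤ : ℕ∞) u := u.contDiff
  have huc : HasCompactSupport u := u.hasCompactSupport
  obtain ⟨a, ha⟩ : ∃ a, a = ∫ y, u y ^ 2 := ⟨_, rfl⟩
  have hapos : 0 < a := by
    rw [ha]
    refine (hus.continuous.pow 2).integral_pos_of_hasCompactSupport_nonneg_nonzero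
      (huc.comp_left (g := fun a : ℝ => a ^ 2) (by simp)) (fun y => sq_nonneg _) (x := 0) ?_
    have : u 0 = 1 := u.one_of_mem_closedBall (by simp [u])
    simp [this]
  obtain ⟨G, hG⟩ : ∃ G, G = ∑ k, ∫ y, fderiv ℝ u y (Pi.single k 1) ^ 2 := ⟨_, rfl⟩
  have hG0 : 0 ≤ G := by
    rw [hG]
    exact Finset.sum_nonneg fun k _ => integral_nonneg fun y => sq_nonneg _
  obtain ⟨μ, hμ⟩ : ∃ μ, μ = min 1 (ε / (G / a + 1)) := ⟨_, rfl⟩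
  have hμ0 : 0 < μ := by rw [hμ]; positivity
  have hμε : μ ^ 2 * (G / a) ≤ ε := by
    have h1 : μ ≤ 1 := hμ ▸ min_le_left _ _
    have h2 : μ * (G / a + 1) ≤ ε :=
      (le_div_iff₀ (by positivity)).1 (hμ ▸ min_le_right _ _)
    have h3 : 0 ≤ G / a := by positivity
    nlinarith
  have hscale : ∀ (F : (Fin 3 → ℝ) → ℝ) (p : Fin 3 → ℝ),
      ∫ y, F (μ • (y - p)) = (μ ^ 3)⁻¹ * ∫ y, F y := by
    intro F p
    rw [integral_sub_right_eq_self (fun y => F (μ • y)) p,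
      Measure.integral_comp_smul_of_nonneg volume F μ (hR := hμ0.le)]
    simp
  let p : Fin 3 → ℝ := fun _ => |R| + 2 / μ
  have hp : ‖p‖ = |R| + 2 / μ := by
    rw [pi_norm_const, Real.norm_eq_abs, abs_of_nonneg (by positivity)]
  obtain ⟨c, hc⟩ : ∃ c, c = Real.sqrt (μ ^ 3 / a) := ⟨_, rfl⟩
  have hc2 : c ^ 2 = μ ^ 3 / a := by rw [hc, Real.sq_sqrt (by positivity)]
  have hin : ContDiff ℝ (⊤ : ℕ∞) fun y : Fin 3 → ℝ => μ • (y - p) := by fun_prop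
  have hsupp : ∀ y, c * u (μ • (y - p)) ≠ 0 → ‖μ • (y - p)‖ < 2 := by
    intro y hy
    have : μ • (y - p) ∈ Function.support u := right_ne_zero_of_mul hy
    rw [u.support_eq] at this
    simpa [u] using this
  have hsupp' : ∀ y, c * u (μ • (y - p)) ≠ 0 → ‖y - p‖ < 2 / μ := by
    intro y hy
    have := hsupp y hy
    rw [norm_smul, Real.norm_eq_abs, abs_of_pos hμ0] at this
    rwa [lt_div_iff₀' hμ0]
  refine ⟨fun y => c * u (μ • (y - p)), contDiff_const.mul (hus.comp hin), ?_, ?_, ?_, ?_⟩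
  · refine HasCompactSupport.of_support_subset_isCompact (isCompact_closedBall p (2 / μ))
      fun y hy => ?_
    rw [mem_closedBall_iff_norm]
    exact (hsupp' y hy).le
  · intro y hy
    have h1 := hsupp' y hy
    have h2 := norm_sub_norm_le p y
    rw [norm_sub_rev, hp] at h2
    linarith [le_abs_self R]
  · simp only [mul_pow, integral_const_mul, hscale (fun y => u y ^ 2), ← ha, hc2]
    field_simp
  · have hderiv : ∀ y k, fderiv ℝ (fun y => c * u (μ • (y - p))) y (Pi.single k 1) =
        c * μ * fderiv ℝ u (μ • (y - p)) (Pi.single k 1) := by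
      intro y k
      have h1 : HasFDerivAt (fun y : Fin 3 → ℝ => μ • (y - p))
          (μ • ContinuousLinearMap.id ℝ (Fin 3 → ℝ)) y :=
        ((hasFDerivAt_id y).sub_const p).const_smul μ
      have h2 := (((hus.differentiable (by simp) _).hasFDerivAt.comp y h1).const_mul c).fderiv
      have h3 : fderiv ℝ (fun y => c * u (μ • (y - p))) y = _ := h2
      rw [h3]
      simp [mul_assoc]
    have hk : ∀ k, ∫ y, fderiv ℝ u (μ • (y - p)) (Pi.single k 1) ^ 2 =
        (μ ^ 3)⁻¹ * ∫ y, fderiv ℝ u y (Pi.single k 1) ^ 2 := fun k =>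
      hscale (fun y => fderiv ℝ u y (Pi.single k 1) ^ 2) p
    simp only [hderiv, mul_pow, integral_const_mul, hk, ← Finset.mul_sum, ← hG, hc2]
    refine le_trans (le_of_eq ?_) hμε
    field_simp

end FarAway

section GroundState

variable {w θ : (Fin 3 → ℝ) → ℝ} {A : (Fin 3 → ℝ) → Fin 3 → ℝ} {B : ℝ}

/-- A particle can be added far away at arbitrarily small energy cost. -/
lemma exists_isWaveFun_succ_energy_le {n : ℕ}
    {Ψ : (Fin n → Fin 3 → ℝ) → (Fin n → Fin 2) → ℂ} (h : IsWaveFun n Ψ) (hw : Measurable w)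
    (hB : ∀ y, |w y| ≤ B) (hw0 : ∀ y, 0 ≤ w y) (hθ : ContDiff ℝ (⊤ : ℕ∞) θ) (hA : Continuous A)
    {R₀ : ℝ} (hθR : ∀ y, R₀ ≤ ‖y‖ → θ y = 1) (hAR : ∀ y, R₀ ≤ ‖y‖ → A y = 0) {ε : ℝ}
    (hε : 0 < ε) :
    ∃ Φ, IsWaveFun (n + 1) Φ ∧ energy w θ A Φ ≤ energy w θ A Ψ + ε := by
  have hs := h.smoothCompact
  choose ρ hρ using fun s => (h.compactSupport s).isBounded.exists_norm_le
  obtain ⟨R₁, hR₁⟩ := (Set.finite_range ρ).bddAbove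
  obtain ⟨R, hRdef⟩ : ∃ R, R = max R₀ R₁ := ⟨_, rfl⟩
  have hR : ∀ x s, Ψ x s ≠ 0 → ‖x‖ ≤ R := fun x s hx =>
    (hρ s x (subset_tsupport _ hx)).trans
      ((hR₁ ⟨s, rfl⟩).trans (hRdef ▸ le_max_right _ _))
  obtain ⟨ℓ, hℓdef⟩ : ∃ ℓ : ℝ, ℓ = 2 * (n + 1) / ε := ⟨_, rfl⟩
  have hℓ : 0 < ℓ := by rw [hℓdef]; positivity
  have hℓε : (n + 1) / ℓ = ε / 2 := by rw [hℓdef]; field_simp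
  obtain ⟨φ, hφ, hφc, hφR, hφ1, hφε⟩ := exists_far_bump (ε := ε / 4) (by positivity) (R + ℓ)
  have hfar : ∀ y, φ y ≠ 0 → R₀ ≤ ‖y‖ := fun y hy =>
    (hRdef ▸ le_max_left R₀ R₁ : R₀ ≤ R).trans (by linarith [hφR y hy])
  have hAφ : ∀ y k, A y k * φ y = 0 := by
    intro y k
    by_cases hy : φ y = 0
    · simp [hy]
    · simp [hAR y (hfar y hy)]
  have hθφ : ∀ y, θ y * φ y = φ y := by
    intro y
    by_cases hy : φ y = 0
    · simp [hy]
    · simp [hθR y (hfar y hy)]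
  let χ : Fin 2 → ℂ := Pi.single 0 1
  have hχ : ∑ τ, ‖χ τ‖ ^ 2 = 1 := by simp [χ]
  let f : (Fin 3 → ℝ) → Fin 2 → ℂ := fun y τ => (φ y : ℂ) * χ τ
  have hfs : ∀ τ, ContDiff ℝ (⊤ : ℕ∞) fun y => f y τ := fun τ =>
    (Complex.ofRealCLM.contDiff.comp hφ).mul contDiff_const
  have hfc : ∀ τ, HasCompactSupport fun y => f y τ := fun τ =>
    (hφc.comp_left (g := fun a : ℝ => (a : ℂ)) (by simp)).mul_right
  have hf : ∀ y τ, f y τ ≠ 0 → R + ℓ ≤ ‖y‖ := fun y τ hy =>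
    hφR y fun h0 => hy (by simp [f, h0])
  have hnorm : ∀ j, normSq (tensorAt j f Ψ) = 1 := by
    intro j
    rw [normSq_tensorAt hs hfs hfc, h.normSq_eq]
    simp only [f, norm_mul, mul_pow, Complex.norm_real, Real.norm_eq_abs, sq_abs,
      integral_mul_const, hφ1, one_mul, hχ, mul_one]
  have hen : ∀ j, energy w θ A (tensorAt j f Ψ) ≤ energy w θ A Ψ + ε := by
    intro j
    have h1 := energy_tensorAt_le h hfs hfc hw hB hθ hA j
    have h2 := spinInt_partDens_tensorAt_le h hφ hφc hAφ hθφ hχ hR hℓ hφR hw hB hw0 hθ hA j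
    rw [hφ1, hℓε] at h2
    rw [hnorm] at h1
    linarith
  have hwedge : SmoothCompact (wedge f Ψ) :=
    SmoothCompact.sum _ fun j => (hs.tensorAt hfs hfc j).const_mul _
  have hN : normSq (wedge f Ψ) = n + 1 := by
    rw [normSq_wedge hs hfs hfc hR hℓ hf]
    simp [hnorm]
  have hpos : 0 < normSq (wedge f Ψ) := by rw [hN]; positivity
  refine ⟨_, (antisymm_wedge h.antisymm).isWaveFun_const_mul hwedge hpos, ?_⟩
  rw [energy_const_mul _ hwedge hθ, Complex.norm_real, Real.norm_eq_abs, sq_abs, inv_pow,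
    Real.sq_sqrt hpos.le, inv_mul_eq_div, div_le_iff₀ hpos, hN,
    energy_wedge hs hfs hfc hR hℓ hf hw hB hθ hA]
  refine (Finset.sum_le_sum fun j _ => hen j).trans (le_of_eq ?_)
  simp only [Finset.sum_const, Finset.card_univ, Fintype.card_fin, nsmul_eq_mul]
  push_cast
  ring

lemma exists_isWaveFun (N : ℕ) : ∃ Ψ, IsWaveFun N Ψ := by
  induction N with
  | zero =>
    refine ⟨fun _ _ => 1, fun _ => contDiff_const, fun _ => ?_, fun π _ _ => ?_, ?_⟩
    · exact HasCompactSupport.of_compactSpace _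
    · simp [Subsingleton.elim π 1]
    · simp [Measure.real, volume_pi]
  | succ n ih =>
    obtain ⟨Ψ, hΨ⟩ := ih
    obtain ⟨Φ, hΦ, -⟩ := exists_isWaveFun_succ_energy_le (w := fun _ => 0) (θ := fun _ => 1)
      (A := fun _ => 0) (B := 0) (R₀ := 0) hΨ measurable_const (by simp) (by simp)
      contDiff_const continuous_const (by simp) (by simp) one_pos
    exact ⟨Φ, hΦ⟩

/-- The ground state energy without the field energy. -/
def groundEnergy (N : ℕ) (w θ : (Fin 3 → ℝ) → ℝ) (A : (Fin 3 → ℝ) → Fin 3 → ℝ) : ℝ :=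
  sInf {E | ∃ Ψ, IsWaveFun N Ψ ∧ E = energy w θ A Ψ}

lemma groundEnergy_le {N : ℕ} {Ψ : (Fin N → Fin 3 → ℝ) → (Fin N → Fin 2) → ℂ}
    (h : IsWaveFun N Ψ) (hw : Measurable w) (hB : ∀ y, |w y| ≤ B)
    (hθ : ContDiff ℝ (⊤ : ℕ∞) θ) (hA : Continuous A) :
    groundEnergy N w θ A ≤ energy w θ A Ψ := by
  refine csInf_le ⟨-(N * B), ?_⟩ ⟨Ψ, h, rfl⟩
  rintro _ ⟨Φ, hΦ, rfl⟩
  have := neg_mul_normSq_le_energy hΦ.smoothCompact hw hB hθ hA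
  rwa [hΦ.normSq_eq, mul_one] at this

lemma le_groundEnergy {N : ℕ} {e : ℝ} (he : ∀ Ψ, IsWaveFun N Ψ → e ≤ energy w θ A Ψ) :
    e ≤ groundEnergy N w θ A := by
  obtain ⟨Ψ, hΨ⟩ := exists_isWaveFun N
  refine le_csInf ⟨_, Ψ, hΨ, rfl⟩ ?_
  rintro _ ⟨Φ, hΦ, rfl⟩
  exact he Φ hΦ

lemma groundEnergy_succ_eq {n : ℕ} {d L R₀ : ℝ} (hw : Measurable w) (hB : ∀ y, |w y| ≤ B)
    (hw0 : ∀ y, 0 ≤ w y) (hθ : ContDiff ℝ (⊤ : ℕ∞) θ) (hθ1 : ∀ y, |θ y| ≤ 1) (hA : Continuous A)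
    (hθR : ∀ y, R₀ ≤ ‖y‖ → θ y = 1) (hAR : ∀ y, R₀ ≤ ‖y‖ → A y = 0) (hd : 0 < d)
    (hL : ∀ y, w y * regDist d y ≤ L) (hn : L + 1 / (2 * d) + 2 ≤ n / 4) :
    groundEnergy (n + 1) w θ A = groundEnergy n w θ A := by
  refine le_antisymm (le_groundEnergy fun Ψ hΨ => le_of_forall_pos_le_add fun ε hε => ?_) ?_
  · obtain ⟨Φ, hΦ, hle⟩ := exists_isWaveFun_succ_energy_le hΨ hw hB hw0 hθ hA hθR hAR hε
    exact (groundEnergy_le hΦ hw hB hθ hA).trans hle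
  · by_contra! hlt
    obtain ⟨κ, hκ, hle⟩ := exists_add_le_energy hw hB hw0 hθ hθ1 hA hd hL hn
      (fun Ψ hΨ => groundEnergy_le hΨ hw hB hθ hA) (fun Ψ hΨ => groundEnergy_le hΨ hw hB hθ hA) hlt
    linarith [le_groundEnergy hle]

lemma truncGS_eq {N : ℕ} {Z α r : ℝ} {θ₀ θ₁ : (Fin 3 → ℝ) → ℝ}
    (hw : Measurable fun y => Wloc Z θ₀ θ₁ y * θ₀ y ^ 2)
    (hB : ∀ y, |Wloc Z θ₀ θ₁ y * θ₀ y ^ 2| ≤ B) (hθ : ContDiff ℝ (⊤ : ℕ∞) θ₀)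
    (hA : Continuous A) :
    truncGS N Z α r θ₀ θ₁ A = groundEnergy N (fun y => Wloc Z θ₀ θ₁ y * θ₀ y ^ 2) θ₀ A
      + (16 * Real.pi * α ^ 2)⁻¹ * ∫ x in ball3 (3 * r), gradSq A x := by
  have hset : {E | ∃ Ψ, IsWaveFun N Ψ ∧ E = truncEnergy N Z α r θ₀ θ₁ A Ψ} =
      {E | ∃ Ψ, IsWaveFun N Ψ ∧ E = energy (fun y => Wloc Z θ₀ θ₁ y * θ₀ y ^ 2) θ₀ A Ψ
        + (16 * Real.pi * α ^ 2)⁻¹ * ∫ x in ball3 (3 * r), gradSq A x} := by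
    ext E
    exact exists_congr fun Ψ => and_congr_right fun hΨ => by
      rw [truncEnergy_eq hΨ.smoothCompact hw hB hθ hA]
  obtain ⟨Ψ, hΨ⟩ := exists_isWaveFun N
  rw [truncGS, hset]
  refine le_antisymm ?_ (le_csInf ⟨_, Ψ, hΨ, rfl⟩ ?_)
  · rw [← sub_le_iff_le_add]
    refine le_groundEnergy fun Φ hΦ => ?_
    rw [sub_le_iff_le_add]
    refine csInf_le ⟨groundEnergy N (fun y => Wloc Z θ₀ θ₁ y * θ₀ y ^ 2) θ₀ A
      + (16 * Real.pi * α ^ 2)⁻¹ * ∫ x in ball3 (3 * r), gradSq A x, ?_⟩ ⟨Φ, hΦ, rfl⟩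
    rintro _ ⟨Φ', hΦ', rfl⟩
    gcongr
    exact groundEnergy_le hΦ' hw hB hθ hA
  · rintro _ ⟨Φ, hΦ, rfl⟩
    gcongr
    exact groundEnergy_le hΦ hw hB hθ hA

end GroundState

namespace AdmissibleCutoffs

variable {d c₁ : ℝ} {θ₀ θ₁ : (Fin 3 → ℝ) → ℝ}

lemma eq_zero₀ (h : AdmissibleCutoffs d c₁ θ₀ θ₁) {y : Fin 3 → ℝ} (hy : enorm3 y ≤ d) :
    θ₀ y = 0 := by
  have := h.partition y
  rw [h.one₁ y hy] at this
  exact pow_eq_zero_iff two_ne_zero |>.1 (by linarith)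

lemma eq_one₀ (h : AdmissibleCutoffs d c₁ θ₀ θ₁) {y : Fin 3 → ℝ} (hy : 2 * d < enorm3 y) :
    θ₀ y = 1 := by
  have := h.partition y
  rw [h.support₁ y hy] at this
  nlinarith [(h.mem₀ y).1]

lemma grad3_eq_zero (h : AdmissibleCutoffs d c₁ θ₀ θ₁) {y : Fin 3 → ℝ}
    (hy : 2 * d < enorm3 y) : grad3 θ₀ y = 0 ∧ grad3 θ₁ y = 0 := by
  have hev : ∀ᶠ x in nhds y, 2 * d < enorm3 x :=
    (continuous_enorm3.tendsto y).eventually (lt_mem_nhds hy)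
  have h0 : θ₀ =ᶠ[nhds y] fun _ => 1 := hev.mono fun x hx => h.eq_one₀ hx
  have h1 : θ₁ =ᶠ[nhds y] fun _ => 0 := hev.mono fun x hx => h.support₁ x hx
  constructor <;> funext k <;> simp [grad3, h0.fderiv_eq, h1.fderiv_eq]

lemma measurable_Wloc_mul (h : AdmissibleCutoffs d c₁ θ₀ θ₁) (Z : ℝ) :
    Measurable fun y => Wloc Z θ₀ θ₁ y * θ₀ y ^ 2 := by
  have hg : ∀ {θ : (Fin 3 → ℝ) → ℝ}, ContDiff ℝ (⊤ : ℕ∞) θ →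
      Measurable fun y => ∑ k, grad3 θ y k ^ 2 := fun {θ} hθ =>
    (continuous_finsetSum _ fun k _ =>
      ((hθ.continuous_fderiv (by simp)).clm_apply continuous_const).pow 2).measurable
  exact (((measurable_const.div continuous_enorm3.measurable).add (hg h.smooth₀)).add
    (hg h.smooth₁)).mul (h.smooth₀.continuous.pow 2).measurable

lemma Wloc_nonneg {Z : ℝ} (hZ : 0 ≤ Z) (y : Fin 3 → ℝ) : 0 ≤ Wloc Z θ₀ θ₁ y := by
  have := enorm3_nonneg y
  unfold Wloc
  positivity

lemma Wloc_mul_regDist_le (h : AdmissibleCutoffs d c₁ θ₀ θ₁) (hd : 0 < d) {Z : ℝ}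
    (hZ : 0 ≤ Z) (y : Fin 3 → ℝ) :
    Wloc Z θ₀ θ₁ y * θ₀ y ^ 2 * regDist d y ≤ 2 * Z + 6 * c₁ ^ 2 / d := by
  have hC : 0 ≤ 6 * c₁ ^ 2 / d := by positivity
  rcases le_or_gt (enorm3 y) d with hy | hy
  · rw [h.eq_zero₀ hy]
    simpa using add_nonneg (mul_nonneg two_pos.le hZ) hC
  have hpos := regDist_pos hd y
  have hsq := regDist_sq hd y
  have h1 : θ₀ y ^ 2 ≤ 1 := pow_le_one₀ (h.mem₀ y).1 (h.mem₀ y).2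
  have h2 : Z / enorm3 y * regDist d y ≤ 2 * Z := by
    rw [div_mul_eq_mul_div, div_le_iff₀ (hd.trans hy)]
    have : regDist d y ≤ 2 * enorm3 y := by nlinarith
    nlinarith
  have h3 : (∑ k, grad3 θ₀ y k ^ 2 + ∑ k, grad3 θ₁ y k ^ 2) * regDist d y ≤
      6 * c₁ ^ 2 / d := by
    rcases le_or_gt (enorm3 y) (2 * d) with hy2 | hy2
    · have h4 : regDist d y ≤ 3 * d := by nlinarith
      have h5 := pow_le_pow_left₀ (enorm3_nonneg _) (h.grad₀ y) 2
      have h6 := pow_le_pow_left₀ (enorm3_nonneg _) (h.grad₁ y) 2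
      rw [enorm3_sq] at h5 h6
      calc _ ≤ ((c₁ / d) ^ 2 + (c₁ / d) ^ 2) * (3 * d) := by gcongr
        _ = 6 * c₁ ^ 2 / d := by field_simp; ring
    · simpa [h.grad3_eq_zero hy2] using hC
  calc _ ≤ Wloc Z θ₀ θ₁ y * 1 * regDist d y := by
        gcongr
        exact Wloc_nonneg hZ y
    _ ≤ 2 * Z + 6 * c₁ ^ 2 / d := by rw [Wloc]; linarith

end AdmissibleCutoffs

/-- Ruskai–Sigal-type bound for the truncated Hamiltonian: for N ≥ C·Z the ground
state energy no longer decreases when adding an electron,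
E⁰_{N,Z}(A) = E⁰_{N−1,Z}(A). -/
theorem truncated_electron_number_bound (c₁ : ℝ) (hc₁ : 0 < c₁) :
    ∃ c C : ℝ, 0 < c ∧ 0 < C ∧ ∀ Z α D δ : ℝ, 1 ≤ Z → 0 < α → 1 ≤ D →
      Z ^ (-(1 : ℝ) / 6) ≤ δ → δ ≤ c →
      ∀ θ₀ θ₁, AdmissibleCutoffs (δ * Z ^ (-(1 : ℝ) / 3)) c₁ θ₀ θ₁ →
      ∀ A, IsVecPot A → ∀ N : ℕ, C * Z ≤ (N : ℝ) →
        truncGS N Z α (D * Z ^ (-(1 : ℝ) / 3)) θ₀ θ₁ A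
          = truncGS (N - 1) Z α (D * Z ^ (-(1 : ℝ) / 3)) θ₀ θ₁ A := by
  refine ⟨1, 4 * (2 + 6 * c₁ ^ 2 + 1 / 2 + 2) + 1, one_pos, by positivity, ?_⟩
  intro Z α D δ hZ _ _ hδ _ θ₀ θ₁ hadm A hA N hN
  obtain ⟨d, hd⟩ : ∃ d, d = δ * Z ^ (-(1 : ℝ) / 3) := ⟨_, rfl⟩
  rw [← hd] at hadm
  have hZ0 : 0 < Z := one_pos.trans_le hZ
  have hd0 : 0 < d := by
    have := (Real.rpow_pos_of_pos hZ0 (-(1 : ℝ) / 6)).trans_le hδ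
    rw [hd]
    positivity
  have hdZ : 1 / d ≤ Z := by
    rw [one_div]
    refine inv_le_of_inv_le₀ hZ0 ?_
    calc Z⁻¹ = Z ^ (-1 : ℝ) := (Real.rpow_neg_one Z).symm
      _ ≤ Z ^ (-(1 : ℝ) / 6 + -(1 : ℝ) / 3) := Real.rpow_le_rpow_of_exponent_le hZ (by norm_num)
      _ = Z ^ (-(1 : ℝ) / 6) * Z ^ (-(1 : ℝ) / 3) := Real.rpow_add hZ0 _ _
      _ ≤ d := by rw [hd]; gcongr
  obtain ⟨n, rfl⟩ : ∃ n, N = n + 1 := by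
    refine Nat.exists_eq_add_one.2 (Nat.cast_pos.1 (lt_of_lt_of_le ?_ hN) : 0 < N)
    positivity
  have hw0 : ∀ y, 0 ≤ Wloc Z θ₀ θ₁ y * θ₀ y ^ 2 := fun y =>
    mul_nonneg (AdmissibleCutoffs.Wloc_nonneg hZ0.le y) (sq_nonneg _)
  have hL := hadm.Wloc_mul_regDist_le hd0 hZ0.le
  have hB : ∀ y, |Wloc Z θ₀ θ₁ y * θ₀ y ^ 2| ≤ (2 * Z + 6 * c₁ ^ 2 / d) / d := by
    intro y
    rw [abs_of_nonneg (hw0 y), le_div_iff₀ hd0]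
    exact (mul_le_mul_of_nonneg_left (le_regDist hd0 y) (hw0 y)).trans (hL y)
  have hw := hadm.measurable_Wloc_mul Z
  have hAc := hA.1.continuous
  obtain ⟨R, hR⟩ := hA.2.1.isBounded.exists_norm_le
  have hnb : 2 * Z + 6 * c₁ ^ 2 / d + 1 / (2 * d) + 2 ≤ (n : ℝ) / 4 := by
    have h1 : 6 * c₁ ^ 2 / d ≤ 6 * c₁ ^ 2 * Z := by
      rw [div_eq_mul_one_div]
      gcongr
    have h2 : 1 / (2 * d) = 1 / d / 2 := by field_simp
    push_cast at hN
    rw [h2]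
    linarith
  rw [Nat.add_sub_cancel, truncGS_eq hw hB hadm.smooth₀ hAc, truncGS_eq hw hB hadm.smooth₀ hAc,
    groundEnergy_succ_eq (R₀ := max (2 * d) R + 1) hw hB hw0 hadm.smooth₀
      (fun y => abs_le.2 ⟨by linarith [(hadm.mem₀ y).1], (hadm.mem₀ y).2⟩) hAc
      (fun y hy => hadm.eq_one₀ ?_) (fun y hy => ?_) hd0 hL hnb]
  · linarith [norm_le_enorm3 y, le_max_left (2 * d) R]
  · by_contra h0
    linarith [hR y (subset_tsupport _ h0), le_max_right (2 * d) R]
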